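/- (Theorem on the antiperiodic centralizer) On the antiperiodic gl(1|1) spin chain, let e_j := (f_j+f_{j+1})(f_j†+f_{j+1}†) for 1 ≤ j ≤ N−1 and e_N := (f_N − f_1)(f_N† − f_1†), and let u ∈ End(H) be any invertible operator with u f_j u⁻¹ = f_{j+2} for 1 ≤ j ≤ N−2, u f_{N−1} u⁻¹ = −f_1, u f_N u⁻¹ = −f_2, and the same relations for the f_j†. Then the commutant of the unital subalgebra of End(H) generated by {e_1, …, e_N, u, u⁻¹} (the spin-chain representation of the twisted algebra JTL_N^{tw}) equals the unital subalgebra of End(H) generated by F_(2) and F†_(2) (the spin-chain representation of the universal enveloping algebra U(sl(2)) with e ∝ F†_(2), f ∝ F_(2), 2h = [e,f]). -/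

import Mathlib

open Complex Matrix

noncomputable section

namespace SpinChain

/-- The state space of the `N`-site spin chain, `(ℂ²)^{⊗N}` realised as functions on
spin configurations. -/
abbrev V (N : ℕ) := (Fin N → Fin 2) → ℂ

/-- Operators on the spin chain, realised as matrices. -/
abbrev Op (N : ℕ) := Matrix (Fin N → Fin 2) (Fin N → Fin 2) ℂ

def sigmaX : Matrix (Fin 2) (Fin 2) ℂ := !![0, 1; 1, 0]
def sigmaY : Matrix (Fin 2) (Fin 2) ℂ := !![0, -I; I, 0]
def sigmaZ : Matrix (Fin 2) (Fin 2) ℂ := !![1, 0; 0, -1]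
def sigmaPlus : Matrix (Fin 2) (Fin 2) ℂ := ((1 : ℂ)/2) • (sigmaX + I • sigmaY)
def sigmaMinus : Matrix (Fin 2) (Fin 2) ℂ := ((1 : ℂ)/2) • (sigmaX - I • sigmaY)

variable (N : ℕ)

/-- The operator acting as the 2×2 matrix `a` on the `j`-th tensor factor and as the
identity on the others. -/
def site (a : Matrix (Fin 2) (Fin 2) ℂ) (j : Fin N) : Op N :=
  Matrix.of fun x y =>
    a (x j) (y j) * ∏ k ∈ Finset.univ.filter (fun k => k ≠ j), (if x k = y k then (1 : ℂ) else 0)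

/-- Jordan–Wigner string `∏_{k<j} diag(z 0, z 1)_k`. -/
def string (z : Fin 2 → ℂ) (j : Fin N) : Op N :=
  (((List.finRange N).filter (fun k => decide (k < j))).map
    (fun k => site N (Matrix.diagonal z) k)).prod

/-- Jordan–Wigner fermion `c_j := i^{1−j}·(∏_{k<j} diag(−i,i)_k)·σ⁻_j`; here the index
`j : Fin N` labels the physical site `j+1`. -/
def c (j : Fin N) : Op N :=
  (I ^ (-(j : ℤ))) • (string N ![-I, I] j * site N sigmaMinus j)

/-- Jordan–Wigner fermion `c_j† := i^{j−1}·(∏_{k<j} diag(i,−i)_k)·σ⁺_j`. -/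
def cd (j : Fin N) : Op N :=
  (I ^ ((j : ℕ))) • (string N ![I, -I] j * site N sigmaPlus j)

/-- The `gl(1|1)` fermion `f_j := i^j c_j` (physical index `j = j.val + 1`). -/
def f (j : Fin N) : Op N := (I ^ ((j : ℕ) + 1)) • c N j

/-- The `gl(1|1)` fermion `f_j† := i^j c_j†`. -/
def fd (j : Fin N) : Op N := (I ^ ((j : ℕ) + 1)) • cd N j

/-- Cyclic successor on site indices. -/
def fsucc {N : ℕ} (j : Fin N) : Fin N := ⟨(j.val + 1) % N, Nat.mod_lt _ j.pos⟩

/-- Periodic Temperley–Lieb generators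
`e_j = (f_j+f_{j+1})(f_j†+f_{j+1}†)`, with `e_N = (f_N+f_1)(f_N†+f_1†)`. -/
def e (j : Fin N) : Op N := (f N j + f N (fsucc j)) * (fd N j + fd N (fsucc j))

/-- `F_(m) := Σ_{j_1<⋯<j_m} f_{j_1}⋯f_{j_m}`. -/
def Fg (m : ℕ) : Op N :=
  ∑ s ∈ Finset.univ.powersetCard m, ((s.sort (· ≤ ·)).map (f N)).prod

/-- `F†_(m) := Σ_{j_1<⋯<j_m} f†_{j_1}⋯f†_{j_m}`. -/
def Fdg (m : ℕ) : Op N :=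
  ∑ s ∈ Finset.univ.powersetCard m, ((s.sort (· ≤ ·)).map (fd N)).prod

/-- `S^z := (1/2) Σ_j σ^z_j`. -/
def Sz : Op N := ((1 : ℂ)/2) • ∑ j : Fin N, site N sigmaZ j


/-- Cyclic shift of a site index by two. -/
def fshift2 {N : ℕ} (j : Fin N) : Fin N := ⟨(j.val + 2) % N, Nat.mod_lt _ j.pos⟩

/-- Antiperiodic Temperley–Lieb generators: `e_j = (f_j+f_{j+1})(f_j†+f_{j+1}†)`
for `1 ≤ j ≤ N−1` and `e_N = (f_N−f_1)(f_N†−f_1†)`. -/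
def eTw (L : ℕ) (j : Fin (2 * L)) : Op (2 * L) :=
  if h : (j : ℕ) + 1 < 2 * L then
    (f (2 * L) j + f (2 * L) ⟨(j : ℕ) + 1, h⟩) * (fd (2 * L) j + fd (2 * L) ⟨(j : ℕ) + 1, h⟩)
  else
    (f (2 * L) j - f (2 * L) ⟨0, j.pos⟩) * (fd (2 * L) j - fd (2 * L) ⟨0, j.pos⟩)

/-- `u` implements the twisted translation by two sites:
`u f_j u⁻¹ = f_{j+2}` for `1 ≤ j ≤ N−2`, `u f_{N−1} u⁻¹ = −f_1`,
`u f_N u⁻¹ = −f_2`, and the same for the `f_j†`. -/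
def ImplementsTwistedTranslation (L : ℕ) (u : (Op (2 * L))ˣ) : Prop :=
  ∀ j : Fin (2 * L),
    (u : Op (2 * L)) * f (2 * L) j * ((u⁻¹ : (Op (2 * L))ˣ) : Op (2 * L)) =
      (if (j : ℕ) + 2 < 2 * L then f (2 * L) (fshift2 j) else -f (2 * L) (fshift2 j)) ∧
    (u : Op (2 * L)) * fd (2 * L) j * ((u⁻¹ : (Op (2 * L))ˣ) : Op (2 * L)) =
      (if (j : ℕ) + 2 < 2 * L then fd (2 * L) (fshift2 j) else -fd (2 * L) (fshift2 j))

/-- The Jordan–Wigner sign: minus one to the number of occupied sites (spin `0`) before `j`. -/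
def jwSign (j : Fin N) (x : Fin N → Fin 2) : ℂ :=
  ∏ k ∈ Finset.univ.filter (· < j), if x k = 0 then (-1 : ℂ) else 1

/-- The fermionic ladder operator turning spin `v.rev` at site `j` into spin `v`. -/
def ladder (v : Fin 2) (j : Fin N) : Op N :=
  Matrix.of fun x y => if x j = v ∧ y = Function.update x j v.rev then jwSign N j x else 0

variable {N}

lemma ladder_mul (v : Fin 2) (j : Fin N) (P : Op N) (x y : Fin N → Fin 2) :
    (ladder N v j * P) x y =
      if x j = v then jwSign N j x * P (Function.update x j v.rev) y else 0 := by
  rw [Matrix.mul_apply]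
  by_cases h : x j = v
  · simp [ladder, h, ite_mul]
  · simp [ladder, h]

lemma ladder_mulVec (v : Fin 2) (j : Fin N) (ψ : V N) (x : Fin N → Fin 2) :
    (ladder N v j *ᵥ ψ) x =
      if x j = v then jwSign N j x * ψ (Function.update x j v.rev) else 0 := by
  rw [Matrix.mulVec, dotProduct]
  by_cases h : x j = v
  · simp [ladder, h, ite_mul]
  · simp [ladder, h]

lemma site_diagonal (z : Fin 2 → ℂ) (k : Fin N) :
    site N (Matrix.diagonal z) k = Matrix.diagonal fun x => z (x k) := by
  ext x y
  by_cases hxy : x = y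
  · subst hxy; simp [site]
  · rw [Matrix.diagonal_apply_ne _ hxy, site, Matrix.of_apply]
    obtain ⟨l, hl⟩ := Function.ne_iff.mp hxy
    by_cases h : l = k
    · subst h; rw [Matrix.diagonal_apply_ne _ hl, zero_mul]
    · rw [Finset.prod_eq_zero (i := l) (by simp [h]) (by simp [hl]), mul_zero]

lemma string_eq_diagonal (z : Fin 2 → ℂ) (j : Fin N) :
    string N z j =
      Matrix.diagonal fun x => ∏ k ∈ Finset.univ.filter (· < j), z (x k) := by
  have h : (((List.finRange N).filter (fun k => decide (k < j))).map
      (fun k => site N (Matrix.diagonal z) k)) =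
      ((((List.finRange N).filter (fun k => decide (k < j))).map
        (fun k (x : Fin N → Fin 2) => z (x k))).map
        (Matrix.diagonalRingHom (Fin N → Fin 2) ℂ)) := by
    simp [List.map_map, site_diagonal, Function.comp_def]
  rw [string, h, ← map_list_prod]
  have h2 : ((List.finRange N).filter (fun k => decide (k < j))).toFinset =
      Finset.univ.filter (· < j) := by
    ext k; simp
  change Matrix.diagonal _ = _
  congr 1
  ext x
  rw [← h2, List.prod_toFinset _ ((List.nodup_finRange N).filter _)]
  exact (map_list_prod (Pi.evalMonoidHom (fun _ => ℂ) x) _).trans (by rw [List.map_map]; rfl)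

lemma site_apply_offdiag (a : Matrix (Fin 2) (Fin 2) ℂ) (v : Fin 2)
    (ha : ∀ s t, a s t = if s = v ∧ t = v.rev then 1 else 0) (j : Fin N)
    (x y : Fin N → Fin 2) :
    site N a j x y = if x j = v ∧ y = Function.update x j v.rev then 1 else 0 := by
  rw [site, Matrix.of_apply, ha, ite_mul, one_mul, zero_mul]
  by_cases h : x j = v
  · by_cases h2 : y = Function.update x j v.rev
    · subst h2
      simp only [h, Function.update_self, and_self, if_true]
      refine Finset.prod_eq_one fun k hk => ?_
      rw [Function.update_of_ne (by simpa using hk), if_pos rfl]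
    · rw [if_neg (c := _ ∧ y = _) (by simp [h2])]
      split_ifs with h3
      · obtain ⟨l, hl⟩ := Function.ne_iff.mp h2
        have hlj : l ≠ j := by
          rintro rfl
          exact hl (by rw [Function.update_self, h3.2])
        rw [Function.update_of_ne hlj] at hl
        exact Finset.prod_eq_zero (i := l) (by simp [hlj]) (if_neg (Ne.symm hl))
      · rfl
  · simp [h]

lemma card_filter_lt (j : Fin N) : (Finset.univ.filter (· < j)).card = (j : ℕ) := by
  rw [show Finset.univ.filter (· < j) = Finset.Iio j by ext; simp, Fin.card_Iio]

lemma c_eq_ladder (j : Fin N) : c N j = ladder N 1 j := by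
  ext x y
  rw [c, string_eq_diagonal, Matrix.smul_apply, Matrix.diagonal_mul,
    site_apply_offdiag sigmaMinus 1 _ j x y, ladder, Matrix.of_apply, _root_.zpow_neg, zpow_natCast]
  · split_ifs
    · rw [smul_eq_mul, mul_one, jwSign, ← inv_pow, ← card_filter_lt j, ← Finset.prod_const,
        ← Finset.prod_mul_distrib]
      refine Finset.prod_congr rfl fun k _ => ?_
      generalize x k = s
      fin_cases s <;> simp
    · simp
  · intro s t
    fin_cases s <;> fin_cases t <;> simp [sigmaMinus, sigmaX, sigmaY]
    norm_num

lemma cd_eq_ladder (j : Fin N) : cd N j = ladder N 0 j := by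
  ext x y
  rw [cd, string_eq_diagonal, Matrix.smul_apply, Matrix.diagonal_mul,
    site_apply_offdiag sigmaPlus 0 _ j x y, ladder, Matrix.of_apply]
  · split_ifs
    · rw [smul_eq_mul, mul_one, jwSign, ← card_filter_lt j, ← Finset.prod_const,
        ← Finset.prod_mul_distrib]
      refine Finset.prod_congr rfl fun k _ => ?_
      generalize x k = s
      fin_cases s <;> simp
    · simp
  · intro s t
    fin_cases s <;> fin_cases t <;> simp [sigmaPlus, sigmaX, sigmaY]
    norm_num

lemma jwSign_update_of_le {j k : Fin N} (h : k ≤ j) (x : Fin N → Fin 2) (v : Fin 2) :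
    jwSign N k (Function.update x j v) = jwSign N k x := by
  refine Finset.prod_congr rfl fun l hl => ?_
  rw [Function.update_of_ne]
  exact ((Finset.mem_filter.mp hl).2.trans_le h).ne

lemma jwSign_update_rev {j k : Fin N} (h : j < k) (x : Fin N → Fin 2) :
    jwSign N k (Function.update x j (x j).rev) = -jwSign N k x := by
  have hj : j ∈ Finset.univ.filter (· < k) := by simpa using h
  rw [jwSign, jwSign, ← Finset.mul_prod_erase _ _ hj, ← Finset.mul_prod_erase _ _ hj,
    Function.update_self, ← neg_mul]
  congr 1
  · generalize x j = s
    fin_cases s <;> simp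
  · refine Finset.prod_congr rfl fun l hl => ?_
    rw [Function.update_of_ne (Finset.ne_of_mem_erase hl)]

lemma jwSign_mul_self (j : Fin N) (x : Fin N → Fin 2) : jwSign N j x * jwSign N j x = 1 := by
  rw [jwSign, ← Finset.prod_mul_distrib]
  exact Finset.prod_eq_one fun k _ => by split_ifs <;> norm_num

lemma ladder_anticomm_of_lt (v w : Fin 2) {j k : Fin N} (h : j < k) :
    ladder N v j * ladder N w k = -(ladder N w k * ladder N v j) := by
  ext x y
  rw [← mul_one (ladder N w k), ← mul_one (ladder N v j), Matrix.neg_apply, mul_one, mul_one,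
    ladder_mul, ladder_mul, ← mul_one (ladder N w k), ← mul_one (ladder N v j),
    ladder_mul, ladder_mul, Function.update_of_ne h.ne', Function.update_of_ne h.ne,
    Function.update_comm h.ne, jwSign_update_of_le h.le]
  by_cases hj : x j = v
  · subst hj
    rw [jwSign_update_rev h]
    split_ifs <;> ring
  · simp [hj]

lemma ladder_anticomm (v w : Fin 2) {j k : Fin N} (h : j ≠ k) :
    ladder N v j * ladder N w k = -(ladder N w k * ladder N v j) := by
  rcases h.lt_or_gt with h | h
  · exact ladder_anticomm_of_lt v w h
  · rw [ladder_anticomm_of_lt w v h, neg_neg]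

lemma rev_ne (v : Fin 2) : v.rev ≠ v := by fin_cases v <;> simp

lemma ladder_mul_self (v : Fin 2) (j : Fin N) : ladder N v j * ladder N v j = 0 := by
  ext x y
  rw [← mul_one (ladder N v j), mul_one, ladder_mul, ← mul_one (ladder N v j), ladder_mul]
  simp [rev_ne]

lemma ladder_mul_rev (v : Fin 2) (j : Fin N) :
    ladder N v j * ladder N v.rev j = Matrix.diagonal fun x => if x j = v then 1 else 0 := by
  ext x y
  rw [ladder_mul, ← mul_one (ladder N v.rev j), ladder_mul]
  rw [jwSign_update_of_le le_rfl, Function.update_self, if_pos rfl, Function.update_idem,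
    Fin.rev_rev, ← mul_assoc, jwSign_mul_self, one_mul]
  by_cases h : x j = v
  · rw [if_pos h, ← h, Function.update_eq_self]
    by_cases hxy : x = y
    · subst hxy; simp [h]
    · rw [Matrix.diagonal_apply_ne _ hxy, Matrix.one_apply_ne hxy]
  · by_cases hxy : x = y
    · subst hxy; simp [h]
    · rw [Matrix.diagonal_apply_ne _ hxy, if_neg h]

lemma ladder_conjTranspose (v : Fin 2) (j : Fin N) :
    (ladder N v j)ᴴ = ladder N v.rev j := by
  have hs : ∀ x : Fin N → Fin 2, star (jwSign N j x) = jwSign N j x := fun x => by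
    rw [jwSign, star_prod]
    exact Finset.prod_congr rfl fun k _ => by split_ifs <;> simp
  ext x y
  rw [Matrix.conjTranspose_apply, ladder, ladder, Matrix.of_apply, Matrix.of_apply]
  by_cases h : y j = v ∧ x = Function.update y j v.rev
  · obtain ⟨rfl, rfl⟩ := h
    simp [jwSign_update_of_le, hs]
  · rw [if_neg h, if_neg, star_zero]
    rintro ⟨h1, rfl⟩
    apply h
    refine ⟨by simp, ?_⟩
    rw [Function.update_idem, ← h1, Function.update_eq_self]

lemma c_mul_c (j k : Fin N) : c N j * c N k = -(c N k * c N j) := by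
  simp only [c_eq_ladder]
  by_cases h : j = k
  · subst h; simp [ladder_mul_self]
  · exact ladder_anticomm _ _ h

lemma cd_mul_cd (j k : Fin N) : cd N j * cd N k = -(cd N k * cd N j) := by
  simp only [cd_eq_ladder]
  by_cases h : j = k
  · subst h; simp [ladder_mul_self]
  · exact ladder_anticomm _ _ h

lemma c_mul_cd_self (j : Fin N) :
    c N j * cd N j = Matrix.diagonal fun x => if x j = 1 then 1 else 0 := by
  rw [c_eq_ladder, cd_eq_ladder]
  exact ladder_mul_rev 1 j

lemma cd_mul_c_self (j : Fin N) :
    cd N j * c N j = Matrix.diagonal fun x => if x j = 0 then 1 else 0 := by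
  rw [c_eq_ladder, cd_eq_ladder]
  exact ladder_mul_rev 0 j

lemma c_mul_cd (j k : Fin N) :
    c N j * cd N k = (if j = k then 1 else 0) - cd N k * c N j := by
  by_cases h : j = k
  · subst h
    rw [if_pos rfl, c_mul_cd_self, cd_mul_c_self, ← Matrix.diagonal_one, Matrix.diagonal_sub]
    congr 1
    ext x
    generalize x j = s
    fin_cases s <;> simp
  · rw [if_neg h, zero_sub, c_eq_ladder, cd_eq_ladder]
    exact ladder_anticomm _ _ h

section PairedModes

variable {L : ℕ} {R : Type*} [Ring R]

/-- Canonical anticommutation relations for `2L` fermionic modes grouped in `L` pairs, with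
annihilators `a i`, `b i` and creators `A i`, `B i`. -/
structure PairedCAR (a b A B : Fin L → R) : Prop where
  aa : ∀ i j, a i * a j = -(a j * a i)
  ab : ∀ i j, a i * b j = -(b j * a i)
  bb : ∀ i j, b i * b j = -(b j * b i)
  AA : ∀ i j, A i * A j = -(A j * A i)
  AB : ∀ i j, A i * B j = -(B j * A i)
  BB : ∀ i j, B i * B j = -(B j * B i)
  aA : ∀ i j, a i * A j = (if i = j then 1 else 0) - A j * a i
  bB : ∀ i j, b i * B j = (if i = j then 1 else 0) - B j * b i
  aB : ∀ i j, a i * B j = -(B j * a i)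
  bA : ∀ i j, b i * A j = -(A j * b i)

/-- The pair creation operator. -/
def pairRaise (A B : Fin L → R) : R := ∑ k, B k * A k

/-- The pair annihilation operator. -/
def pairLower (a b : Fin L → R) : R := ∑ k, a k * b k

namespace PairedCAR

variable {a b A B : Fin L → R}

lemma mul_mul_anticomm {x y z : R} (hx : x * z = -(z * x)) (hy : y * z = -(z * y)) :
    x * y * z = z * (x * y) := by
  rw [mul_assoc, hy, mul_neg, ← mul_assoc, hx, neg_mul, neg_neg, mul_assoc]

lemma Aa (h : PairedCAR a b A B) (i j) : A i * a j = (if j = i then 1 else 0) - a j * A i := by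
  rw [h.aA, sub_sub_cancel]

lemma Bb (h : PairedCAR a b A B) (i j) : B i * b j = (if j = i then 1 else 0) - b j * B i := by
  rw [h.bB, sub_sub_cancel]

lemma Ba (h : PairedCAR a b A B) (i j) : B i * a j = -(a j * B i) := by rw [h.aB, neg_neg]

lemma Ab (h : PairedCAR a b A B) (i j) : A i * b j = -(b j * A i) := by rw [h.bA, neg_neg]

lemma pairRaise_a (h : PairedCAR a b A B) (i : Fin L) :
    pairRaise A B * a i = a i * pairRaise A B + B i := by
  have : ∀ k, B k * A k * a i = a i * (B k * A k) + if i = k then B k else 0 := fun k => by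
    rw [mul_assoc, h.Aa, mul_sub, ← mul_assoc, h.Ba, ← mul_assoc]
    split_ifs <;> noncomm_ring
  simp [pairRaise, Finset.sum_mul, Finset.mul_sum, this, Finset.sum_add_distrib]

lemma pairRaise_b (h : PairedCAR a b A B) (i : Fin L) :
    pairRaise A B * b i = b i * pairRaise A B - A i := by
  have : ∀ k, B k * A k * b i = b i * (B k * A k) - if i = k then A k else 0 := fun k => by
    rw [mul_assoc, h.Ab, mul_neg, ← mul_assoc, h.Bb, ← mul_assoc]
    split_ifs <;> noncomm_ring
  simp [pairRaise, Finset.sum_mul, Finset.mul_sum, this, Finset.sum_sub_distrib]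

lemma pairRaise_A (h : PairedCAR a b A B) (i : Fin L) :
    pairRaise A B * A i = A i * pairRaise A B := by
  rw [pairRaise, Finset.sum_mul, Finset.mul_sum]
  exact Finset.sum_congr rfl fun k _ =>
    mul_mul_anticomm (by rw [h.AB, neg_neg]) (h.AA _ _)

lemma pairRaise_B (h : PairedCAR a b A B) (i : Fin L) :
    pairRaise A B * B i = B i * pairRaise A B := by
  rw [pairRaise, Finset.sum_mul, Finset.mul_sum]
  exact Finset.sum_congr rfl fun k _ => mul_mul_anticomm (h.BB _ _) (h.AB _ _)

/-- The particle–hole transformation. -/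
lemma particleHole (h : PairedCAR a b A B) : PairedCAR A B a b where
  aa := h.AA
  ab := h.AB
  bb := h.BB
  AA := h.aa
  AB := h.ab
  BB := h.bb
  aA i j := by rw [h.Aa]; simp only [eq_comm]
  bB i j := by rw [h.Bb]; simp only [eq_comm]
  aB := h.Ab
  bA := h.Ba

lemma pairLower_eq (h : PairedCAR a b A B) : pairLower a b = -pairRaise a b := by
  rw [pairLower, pairRaise, ← Finset.sum_neg_distrib]
  exact Finset.sum_congr rfl fun k _ => h.ab _ _

lemma pairLower_A (h : PairedCAR a b A B) (i : Fin L) :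
    pairLower a b * A i = A i * pairLower a b - b i := by
  rw [h.pairLower_eq, neg_mul, h.particleHole.pairRaise_a]
  noncomm_ring

lemma pairLower_B (h : PairedCAR a b A B) (i : Fin L) :
    pairLower a b * B i = B i * pairLower a b + a i := by
  rw [h.pairLower_eq, neg_mul, h.particleHole.pairRaise_b]
  noncomm_ring

lemma pairLower_a (h : PairedCAR a b A B) (i : Fin L) :
    pairLower a b * a i = a i * pairLower a b := by
  rw [h.pairLower_eq, neg_mul, h.particleHole.pairRaise_A, mul_neg]

lemma pairLower_b (h : PairedCAR a b A B) (i : Fin L) :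
    pairLower a b * b i = b i * pairLower a b := by
  rw [h.pairLower_eq, neg_mul, h.particleHole.pairRaise_B, mul_neg]

end PairedCAR

variable [Algebra ℂ R]

/-- The graph of the commutator with the pair creation operator on the span of the
annihilators. -/
def modeSpan (a b A B : Fin L → R) : Submodule ℂ (R × R) :=
  Submodule.span ℂ (Set.range (fun i => (a i, B i)) ∪ Set.range (fun i => (b i, -A i)))

lemma mk_a_mem_modeSpan {a b A B : Fin L → R} (i : Fin L) : (a i, B i) ∈ modeSpan a b A B :=
  Submodule.subset_span (Or.inl ⟨i, rfl⟩)

lemma mk_b_mem_modeSpan {a b A B : Fin L → R} (i : Fin L) : (b i, -A i) ∈ modeSpan a b A B :=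
  Submodule.subset_span (Or.inr ⟨i, rfl⟩)

lemma modeSpan_induction {a b A B : Fin L → R} {P : R × R → Prop}
    (ha : ∀ i, P (a i, B i)) (hb : ∀ i, P (b i, -A i)) (h0 : P 0)
    (hadd : ∀ p q, P p → P q → P (p + q)) (hsmul : ∀ (t : ℂ) p, P p → P (t • p))
    {p : R × R} (hp : p ∈ modeSpan a b A B) : P p := by
  induction hp using Submodule.span_induction with
  | mem x hx =>
    rcases hx with ⟨i, rfl⟩ | ⟨i, rfl⟩
    · exact ha i
    · exact hb i
  | zero => exact h0
  | add p q _ _ hp hq => exact hadd p q hp hq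
  | smul t p _ hp => exact hsmul t p hp

namespace PairedCAR

variable {a b A B : Fin L → R}

lemma pairRaise_fst (h : PairedCAR a b A B) {p : R × R} (hp : p ∈ modeSpan a b A B) :
    pairRaise A B * p.1 = p.1 * pairRaise A B + p.2 := by
  refine modeSpan_induction (P := fun p => pairRaise A B * p.1 = p.1 * pairRaise A B + p.2)
    h.pairRaise_a (fun i => ?_) (by simp) (fun p q hp hq => ?_) (fun t p hp => ?_) hp
  · rw [h.pairRaise_b]; noncomm_ring
  · simp only [Prod.fst_add, Prod.snd_add, mul_add, add_mul, hp, hq]; abel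
  · simp [hp]

lemma pairRaise_snd (h : PairedCAR a b A B) {p : R × R} (hp : p ∈ modeSpan a b A B) :
    pairRaise A B * p.2 = p.2 * pairRaise A B := by
  refine modeSpan_induction (P := fun p => pairRaise A B * p.2 = p.2 * pairRaise A B)
    h.pairRaise_B (fun i => ?_) (by simp) (fun p q hp hq => ?_) (fun t p hp => ?_) hp
  · simp [h.pairRaise_A]
  · simp only [Prod.snd_add, mul_add, add_mul, hp, hq]
  · simp [hp]

lemma pairLower_snd (h : PairedCAR a b A B) {p : R × R} (hp : p ∈ modeSpan a b A B) :
    pairLower a b * p.2 = p.2 * pairLower a b + p.1 := by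
  refine modeSpan_induction (P := fun p => pairLower a b * p.2 = p.2 * pairLower a b + p.1)
    h.pairLower_B (fun i => ?_) (by simp) (fun p q hp hq => ?_) (fun t p hp => ?_) hp
  · simp only [mul_neg, h.pairLower_A]; noncomm_ring
  · simp only [Prod.fst_add, Prod.snd_add, mul_add, add_mul, hp, hq]; abel
  · simp [hp]

lemma pairLower_fst (h : PairedCAR a b A B) {p : R × R} (hp : p ∈ modeSpan a b A B) :
    pairLower a b * p.1 = p.1 * pairLower a b := by
  refine modeSpan_induction (P := fun p => pairLower a b * p.1 = p.1 * pairLower a b)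
    h.pairLower_a h.pairLower_b (by simp) (fun p q hp hq => ?_) (fun t p hp => ?_) hp
  · simp only [Prod.fst_add, mul_add, add_mul, hp, hq]
  · simp [hp]

lemma fst_anticomm (h : PairedCAR a b A B) {p q : R × R} (hp : p ∈ modeSpan a b A B)
    (hq : q ∈ modeSpan a b A B) :
    p.1 * q.1 = -(q.1 * p.1) := by
  have key : ∀ x : R, (∀ i, x * a i = -(a i * x)) → (∀ i, x * b i = -(b i * x)) →
      x * q.1 = -(q.1 * x) := fun x h1 h2 => by
    refine modeSpan_induction (P := fun q => x * q.1 = -(q.1 * x)) h1 h2 (by simp)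
      (fun p q hp hq => ?_) (fun t p hp => ?_) hq
    · simp only [Prod.fst_add, mul_add, add_mul, hp, hq]; abel
    · simp [hp]
  refine modeSpan_induction (P := fun p => p.1 * q.1 = -(q.1 * p.1))
    (fun i => key _ (h.aa i) (h.ab i)) (fun i => key _ (fun j => ?_) (h.bb i)) (by simp)
    (fun p q hp hq => ?_) (fun t p hp => ?_) hp
  · rw [h.ab, neg_neg]
  · simp only [Prod.fst_add, mul_add, add_mul, hp, hq]; abel
  · simp [hp]

lemma snd_anticomm (h : PairedCAR a b A B) {p q : R × R} (hp : p ∈ modeSpan a b A B)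
    (hq : q ∈ modeSpan a b A B) :
    p.2 * q.2 = -(q.2 * p.2) := by
  have key : ∀ x : R, (∀ i, x * A i = -(A i * x)) → (∀ i, x * B i = -(B i * x)) →
      x * q.2 = -(q.2 * x) := fun x h1 h2 => by
    refine modeSpan_induction (P := fun q => x * q.2 = -(q.2 * x)) h2
      (fun i => by simp [h1]) (by simp)
      (fun p q hp hq => ?_) (fun t p hp => ?_) hq
    · simp only [Prod.snd_add, mul_add, add_mul, hp, hq]; abel
    · simp [hp]
  refine modeSpan_induction (P := fun p => p.2 * q.2 = -(q.2 * p.2))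
    (fun i => key _ (fun j => ?_) (h.BB i))
    (fun i => key _ (fun j => ?_) (fun j => ?_)) (by simp)
    (fun p q hp hq => ?_) (fun t p hp => ?_) hp
  · rw [h.AB, neg_neg]
  · simp [h.AA i j]
  · simp [h.AB i j]
  · simp only [Prod.snd_add, mul_add, add_mul, hp, hq]; abel
  · simp [hp]

lemma exists_fst_snd_anticomm (h : PairedCAR a b A B) {p q : R × R} (hp : p ∈ modeSpan a b A B)
    (hq : q ∈ modeSpan a b A B) : ∃ t : ℂ, p.1 * q.2 + q.2 * p.1 = algebraMap ℂ R t := by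
  have key : ∀ x : R, (∀ i, ∃ t : ℂ, x * A i + A i * x = algebraMap ℂ R t) →
      (∀ i, ∃ t : ℂ, x * B i + B i * x = algebraMap ℂ R t) →
      ∃ t : ℂ, x * q.2 + q.2 * x = algebraMap ℂ R t := fun x h1 h2 => by
    refine modeSpan_induction (P := fun q => ∃ t : ℂ, x * q.2 + q.2 * x = algebraMap ℂ R t) h2
      (fun i => ?_) ⟨0, by simp⟩ ?_ ?_ hq
    · obtain ⟨t, ht⟩ := h1 i
      exact ⟨-t, by rw [map_neg, ← ht]; noncomm_ring⟩
    · rintro p q ⟨s, hs⟩ ⟨t, ht⟩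
      exact ⟨s + t, by rw [map_add, ← hs, ← ht]; simp only [Prod.snd_add]; noncomm_ring⟩
    · rintro s p ⟨t, ht⟩
      exact ⟨s * t, by rw [map_mul, ← ht, ← Algebra.smul_def]; simp⟩
  refine modeSpan_induction (P := fun p => ∃ t : ℂ, p.1 * q.2 + q.2 * p.1 = algebraMap ℂ R t)
    (fun i => key _ (fun j => ⟨if i = j then 1 else 0, ?_⟩) (fun j => ⟨0, ?_⟩))
    (fun i => key _ (fun j => ⟨0, ?_⟩) (fun j => ⟨if i = j then 1 else 0, ?_⟩))
    ⟨0, by simp⟩ ?_ ?_ hp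
  · dsimp only; rw [h.aA]; split_ifs <;> simp
  · dsimp only; rw [h.aB]; simp
  · dsimp only; rw [h.bA]; simp
  · dsimp only; rw [h.bB]; split_ifs <;> simp
  · rintro p q ⟨s, hs⟩ ⟨t, ht⟩
    exact ⟨s + t, by rw [map_add, ← hs, ← ht]; simp only [Prod.fst_add]; noncomm_ring⟩
  · rintro s p ⟨t, ht⟩
    exact ⟨s * t, by rw [map_mul, ← ht, ← Algebra.smul_def]; simp⟩

/-- The anticommutator pairing on the mode span is antisymmetric. -/
lemma fst_snd_antisymm (h : PairedCAR a b A B) {p q : R × R} (hp : p ∈ modeSpan a b A B)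
    (hq : q ∈ modeSpan a b A B) :
    q.1 * p.2 + p.2 * q.1 = -(p.1 * q.2 + q.2 * p.1) := by
  have h1 := h.pairRaise_fst hp
  have h2 := h.pairRaise_fst hq
  have h3 := congrArg (pairRaise A B * ·) (h.fst_anticomm hp hq)
  have h4 := congrArg (· * pairRaise A B) (h.fst_anticomm hp hq)
  rw [← sub_eq_iff_eq_add'] at h1 h2
  rw [← h1, ← h2, ← sub_eq_zero]
  have : q.1 * (pairRaise A B * p.1 - p.1 * pairRaise A B)
      + (pairRaise A B * p.1 - p.1 * pairRaise A B) * q.1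
      - -(p.1 * (pairRaise A B * q.1 - q.1 * pairRaise A B)
        + (pairRaise A B * q.1 - q.1 * pairRaise A B) * p.1)
      = (pairRaise A B * (p.1 * q.1) - pairRaise A B * -(q.1 * p.1))
        - (p.1 * q.1 * pairRaise A B - -(q.1 * p.1) * pairRaise A B) := by
    noncomm_ring
  rw [this, sub_eq_zero.mpr h3, sub_eq_zero.mpr h4, sub_zero]

/-- The polarised bilinear attached to two elements of the mode span. -/
lemma bracket_bilinear (h : PairedCAR a b A B) {p q r : R × R} (hp : p ∈ modeSpan a b A B)
    (hq : q ∈ modeSpan a b A B)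
    (hr : r ∈ modeSpan a b A B) {s t : ℂ} (hs : r.1 * q.2 + q.2 * r.1 = algebraMap ℂ R s)
    (ht : r.1 * p.2 + p.2 * r.1 = algebraMap ℂ R t) :
    (p.1 * q.2 + q.1 * p.2) * (r.1 * r.2) - (r.1 * r.2) * (p.1 * q.2 + q.1 * p.2) =
      s • (p.1 * r.2 + r.1 * p.2) + t • (q.1 * r.2 + r.1 * q.2) := by
  have bracket : ∀ {p q : R × R}, p ∈ modeSpan a b A B → q ∈ modeSpan a b A B → ∀ {s t : ℂ},
      r.1 * q.2 + q.2 * r.1 = algebraMap ℂ R s → r.1 * p.2 + p.2 * r.1 = algebraMap ℂ R t →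
      p.1 * q.2 * (r.1 * r.2) - r.1 * r.2 * (p.1 * q.2) =
        s • (p.1 * r.2) + t • (r.1 * q.2) := by
    intro p q hp hq s t hs ht
    have ht' : p.1 * r.2 + r.2 * p.1 = -algebraMap ℂ R t := by
      rw [← ht, h.fst_snd_antisymm hp hr, neg_neg]
    have e1 : p.1 * q.2 * (r.1 * r.2) - r.1 * r.2 * (p.1 * q.2) =
        p.1 * (r.1 * q.2 + q.2 * r.1) * r.2 - r.1 * (p.1 * r.2 + r.2 * p.1) * q.2
          - p.1 * r.1 * (q.2 * r.2) + r.1 * p.1 * (r.2 * q.2) := by noncomm_ring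
    rw [e1, hs, ht', h.fst_anticomm hr hp, h.snd_anticomm hr hq, neg_mul_neg,
      ← Algebra.commutes s, mul_neg, ← Algebra.commutes t, Algebra.smul_def, Algebra.smul_def]
    noncomm_ring
  have e2 := bracket hp hq hs ht
  have e3 := bracket hq hp ht hs
  rw [add_mul, mul_add, add_sub_add_comm, e2, e3, smul_add, smul_add]
  abel

lemma bilinear_mem_of_chain (h : PairedCAR a b A B) {Z : Subalgebra ℂ R} {n : ℕ} {p : ℕ → R × R}
    (hp : ∀ i < n, p i ∈ modeSpan a b A B) (hZ : ∀ i < n, (p i).1 * (p i).2 ∈ Z)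
    (hne : ∀ i, i + 1 < n → (p (i + 1)).1 * (p i).2 + (p i).2 * (p (i + 1)).1 ≠ 0) :
    ∀ i < n, ∀ j < n, (p i).1 * (p j).2 + (p j).1 * (p i).2 ∈ Z := by
  have step : ∀ i j, j + 1 < n → i ≤ j → (p i).1 * (p j).2 + (p j).1 * (p i).2 ∈ Z →
      (i < j → (p j).1 * (p (j + 1)).2 + (p (j + 1)).1 * (p j).2 ∈ Z) →
      (p i).1 * (p (j + 1)).2 + (p (j + 1)).1 * (p i).2 ∈ Z := by
    intro i j hj hij h1 h2
    obtain ⟨s, hs⟩ := h.exists_fst_snd_anticomm (hp (j + 1) hj) (hp j (by omega))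
    obtain ⟨t, ht⟩ := h.exists_fst_snd_anticomm (hp (j + 1) hj) (hp i (by omega))
    have hs0 : s ≠ 0 := by
      rintro rfl
      exact hne j hj (by rw [hs, map_zero])
    have hb := h.bracket_bilinear (hp i (by omega)) (hp j (by omega)) (hp (j + 1) hj) hs ht
    have hmem : s • ((p i).1 * (p (j + 1)).2 + (p (j + 1)).1 * (p i).2)
        + t • ((p j).1 * (p (j + 1)).2 + (p (j + 1)).1 * (p j).2) ∈ Z := by
      rw [← hb]
      exact sub_mem (mul_mem h1 (hZ _ hj)) (mul_mem (hZ _ hj) h1)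
    rcases hij.lt_or_eq with hlt | rfl
    · have := Z.smul_mem (sub_mem hmem (Z.smul_mem (h2 hlt) t)) s⁻¹
      rwa [add_sub_cancel_right, inv_smul_smul₀ hs0] at this
    · have hst : s = t ∨ (1 : R) = 0 := by
        by_cases h01 : (1 : R) = 0
        · exact Or.inr h01
        · left
          have : Nontrivial R := ⟨1, 0, h01⟩
          exact (algebraMap ℂ R).injective (hs.symm.trans ht)
      rcases hst with rfl | h01
      · rw [← add_smul] at hmem
        have := Z.smul_mem hmem (s + s)⁻¹
        rwa [inv_smul_smul₀ (by simpa using hs0)] at this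
      · rw [← one_mul (_ + _), h01, zero_mul]
        exact zero_mem Z
  have diag : ∀ i < n, (p i).1 * (p i).2 + (p i).1 * (p i).2 ∈ Z := fun i hi =>
    add_mem (hZ i hi) (hZ i hi)
  have main : ∀ d i, i + d < n → (p i).1 * (p (i + d)).2 + (p (i + d)).1 * (p i).2 ∈ Z := by
    intro d
    induction d with
    | zero => exact fun i hi => diag i hi
    | succ d ih =>
      intro i hi
      exact step i (i + d) (by omega) (by omega) (ih i (by omega)) fun _ =>
        step (i + d) (i + d) (by omega) le_rfl (diag _ (by omega)) fun hlt =>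
          absurd hlt (lt_irrefl _)
  intro i hi j hj
  rcases le_total i j with hij | hij
  · obtain ⟨d, rfl⟩ := Nat.exists_eq_add_of_le hij
    exact main d i hj
  · obtain ⟨d, rfl⟩ := Nat.exists_eq_add_of_le hij
    rw [add_comm]
    exact main d j hi

lemma pairRaise_commute_bilinear (h : PairedCAR a b A B) {p q : R × R} (hp : p ∈ modeSpan a b A B)
    (hq : q ∈ modeSpan a b A B) :
    Commute (pairRaise A B) (p.1 * q.2 + q.1 * p.2) := by
  rw [Commute, SemiconjBy, mul_add, ← mul_assoc, ← mul_assoc, h.pairRaise_fst hp,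
    h.pairRaise_fst hq, add_mul, add_mul, mul_assoc, mul_assoc, h.pairRaise_snd hp,
    h.pairRaise_snd hq, h.snd_anticomm hp hq]
  noncomm_ring

lemma pairLower_commute_bilinear (h : PairedCAR a b A B) {p q : R × R} (hp : p ∈ modeSpan a b A B)
    (hq : q ∈ modeSpan a b A B) :
    Commute (pairLower a b) (p.1 * q.2 + q.1 * p.2) := by
  rw [Commute, SemiconjBy, mul_add, ← mul_assoc, ← mul_assoc, h.pairLower_fst hp,
    h.pairLower_fst hq, mul_assoc, mul_assoc, h.pairLower_snd hp,
    h.pairLower_snd hq, mul_add, mul_add, h.fst_anticomm hp hq]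
  noncomm_ring

end PairedCAR

end PairedModes

section Density

variable {n ι : Type*} [Fintype n] [DecidableEq n] [DecidableEq ι]

/-- Vectors separated by operators of `B` acting diagonally on them have spectral projections
in `B`. -/
lemma exists_projection_mem (B : Subalgebra ℂ (Matrix n n ℂ)) (s : Finset ι) (w : ι → n → ℂ)
    (hsep : ∀ p ∈ s, ∀ q ∈ s, p ≠ q → ∃ Q ∈ B, Q *ᵥ w p = w p ∧ Q *ᵥ w q = 0 ∧
      ∀ r ∈ s, ∃ t : ℂ, Q *ᵥ w r = t • w r) (p : ι) (hp : p ∈ s) :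
    ∃ P ∈ B, P *ᵥ w p = w p ∧ ∀ q ∈ s, q ≠ p → P *ᵥ w q = 0 := by
  suffices H : ∀ s' ⊆ s, ∃ P ∈ B, P *ᵥ w p = w p ∧ (∀ q ∈ s', q ≠ p → P *ᵥ w q = 0) ∧
      ∀ r ∈ s, ∃ t : ℂ, P *ᵥ w r = t • w r by
    obtain ⟨P, hP, h1, h2, -⟩ := H s subset_rfl
    exact ⟨P, hP, h1, h2⟩
  intro s'
  induction s' using Finset.induction_on with
  | empty => exact fun _ => ⟨1, one_mem B, by simp, by simp, fun r _ => ⟨1, by simp⟩⟩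
  | insert q s' _ ih =>
    intro hs
    obtain ⟨P, hP, h1, h2, h3⟩ := ih ((Finset.subset_insert _ _).trans hs)
    by_cases hqp : q = p
    · subst hqp
      refine ⟨P, hP, h1, fun r hr hne => h2 r ?_ hne, h3⟩
      exact (Finset.mem_insert.mp hr).resolve_left hne
    · have hq : q ∈ s := hs (Finset.mem_insert_self _ _)
      obtain ⟨Q, hQ, k1, k2, k3⟩ := hsep p hp q hq (Ne.symm hqp)
      refine ⟨Q * P, mul_mem hQ hP, ?_, ?_, ?_⟩
      · rw [← mulVec_mulVec, h1, k1]
      · intro r hr hne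
        rw [← mulVec_mulVec]
        rcases Finset.mem_insert.mp hr with rfl | hr
        · obtain ⟨t, ht⟩ := h3 r hq
          rw [ht, mulVec_smul, k2, smul_zero]
        · rw [h2 r hr hne, mulVec_zero]
      · intro r hr
        obtain ⟨t, ht⟩ := h3 r hr
        obtain ⟨t', ht'⟩ := k3 r hr
        exact ⟨t * t', by rw [← mulVec_mulVec, ht, mulVec_smul, ht', smul_smul]⟩

/-- An operator respecting the `B`-orbits of separated vectors agrees on them with some element
of `B`. -/
lemma exists_mem_mulVec_eq (B : Subalgebra ℂ (Matrix n n ℂ)) (s : Finset ι) (w : ι → n → ℂ)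
    (hsep : ∀ p ∈ s, ∀ q ∈ s, p ≠ q → ∃ Q ∈ B, Q *ᵥ w p = w p ∧ Q *ᵥ w q = 0 ∧
      ∀ r ∈ s, ∃ t : ℂ, Q *ᵥ w r = t • w r)
    (X : Matrix n n ℂ) (hX : ∀ p ∈ s, ∃ g ∈ B, g *ᵥ w p = X *ᵥ w p) :
    ∃ g ∈ B, ∀ p ∈ s, g *ᵥ w p = X *ᵥ w p := by
  choose! P hP h1 h2 using exists_projection_mem B s w hsep
  choose! g hg h3 using hX
  refine ⟨∑ p ∈ s, g p * P p, sum_mem fun p hp => mul_mem (hg p hp) (hP p hp), fun p hp => ?_⟩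
  rw [Matrix.sum_mulVec, Finset.sum_eq_single p]
  · rw [← mulVec_mulVec, h1 p hp, h3 p hp]
  · intro q hq hne
    rw [← mulVec_mulVec, h2 q hq p hp hne.symm, mulVec_zero]
  · exact fun hn => absurd hp hn

end Density

section Sites

variable {L : ℕ}

/-- The first mode of the `k`-th pair of sites. -/
def modeA (k : Fin L) : Fin (2 * L) := ⟨2 * k, by omega⟩

/-- The second mode of the `k`-th pair of sites. -/
def modeB (k : Fin L) : Fin (2 * L) := ⟨2 * k + 1, by omega⟩

lemma modeA_injective : Function.Injective (modeA (L := L)) := fun i j h => by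
  simp only [modeA, Fin.mk.injEq] at h
  omega

lemma modeB_injective : Function.Injective (modeB (L := L)) := fun i j h => by
  simp only [modeB, Fin.mk.injEq] at h
  omega

lemma modeA_ne_modeB (i j : Fin L) : modeA i ≠ modeB j := fun h => by
  simp only [modeA, modeB, Fin.mk.injEq] at h
  omega

lemma exists_eq_mode (j : Fin (2 * L)) : ∃ k : Fin L, j = modeA k ∨ j = modeB k := by
  refine ⟨⟨(j : ℕ) / 2, by omega⟩, ?_⟩
  simp only [modeA, modeB, Fin.ext_iff]
  omega

lemma pairedCAR_c (L : ℕ) : PairedCAR (fun k : Fin L => c (2 * L) (modeA k))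
    (fun k => c (2 * L) (modeB k)) (fun k => cd (2 * L) (modeA k))
    (fun k => cd (2 * L) (modeB k)) where
  aa _ _ := c_mul_c _ _
  ab _ _ := c_mul_c _ _
  bb _ _ := c_mul_c _ _
  AA _ _ := cd_mul_cd _ _
  AB _ _ := cd_mul_cd _ _
  BB _ _ := cd_mul_cd _ _
  aA _ _ := by simp [c_mul_cd, modeA_injective.eq_iff]
  bB _ _ := by simp [c_mul_cd, modeB_injective.eq_iff]
  aB _ _ := by simp [c_mul_cd, modeA_ne_modeB]
  bA _ _ := by simp [c_mul_cd, (modeA_ne_modeB _ _).symm]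

/-- Set both spins of the `i`-th pair of sites to `s`. -/
def setSite (x : Fin (2 * L) → Fin 2) (i : Fin L) (s : Fin 2) : Fin (2 * L) → Fin 2 :=
  Function.update (Function.update x (modeA i) s) (modeB i) s

lemma setSite_modeA (x : Fin (2 * L) → Fin 2) (i j : Fin L) (s : Fin 2) :
    setSite x i s (modeA j) = if j = i then s else x (modeA j) := by
  rw [setSite, Function.update_of_ne (modeA_ne_modeB _ _), Function.update_apply]
  simp only [modeA_injective.eq_iff]

lemma setSite_modeB (x : Fin (2 * L) → Fin 2) (i j : Fin L) (s : Fin 2) :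
    setSite x i s (modeB j) = if j = i then s else x (modeB j) := by
  rw [setSite, Function.update_apply, Function.update_of_ne (modeA_ne_modeB _ _).symm]
  simp only [modeB_injective.eq_iff]

lemma config_ext {x y : Fin (2 * L) → Fin 2} (hA : ∀ i, x (modeA i) = y (modeA i))
    (hB : ∀ i, x (modeB i) = y (modeB i)) : x = y := by
  ext j
  obtain ⟨k, rfl | rfl⟩ := exists_eq_mode j
  · rw [hA]
  · rw [hB]

lemma jwSign_modeB (i : Fin L) (x : Fin (2 * L) → Fin 2) :
    jwSign (2 * L) (modeB i) x =
      (if x (modeA i) = 0 then -1 else 1) * jwSign (2 * L) (modeA i) x := by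
  have h : Finset.univ.filter (· < modeB i) =
      insert (modeA i) (Finset.univ.filter (· < modeA i)) := by
    ext j
    simp only [modeA, modeB, Finset.mem_filter_univ, Finset.mem_insert, Fin.ext_iff, Fin.lt_def]
    omega
  rw [jwSign, h, Finset.prod_insert (by simp), jwSign]

lemma lower_mulVec (i : Fin L) (ψ : V (2 * L)) (x : Fin (2 * L) → Fin 2) :
    ((c (2 * L) (modeA i) * c (2 * L) (modeB i)) *ᵥ ψ) x =
      if x (modeA i) = 1 ∧ x (modeB i) = 1 then -ψ (setSite x i 0) else 0 := by
  rw [← mulVec_mulVec, c_eq_ladder, c_eq_ladder, ladder_mulVec, ladder_mulVec,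
    Function.update_of_ne (modeA_ne_modeB _ _).symm, jwSign_modeB, Function.update_self,
    jwSign_update_of_le le_rfl]
  by_cases h1 : x (modeA i) = 1
  · by_cases h2 : x (modeB i) = 1
    · simp only [h1, h2, and_self, if_true]
      rw [if_pos (by decide), neg_one_mul, neg_mul, mul_neg, ← mul_assoc, jwSign_mul_self, one_mul]
      rfl
    · simp [h2]
  · simp [h1]

lemma raise_mulVec (i : Fin L) (ψ : V (2 * L)) (x : Fin (2 * L) → Fin 2) :
    ((cd (2 * L) (modeB i) * cd (2 * L) (modeA i)) *ᵥ ψ) x =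
      if x (modeA i) = 0 ∧ x (modeB i) = 0 then -ψ (setSite x i 1) else 0 := by
  rw [← mulVec_mulVec, cd_eq_ladder, cd_eq_ladder, ladder_mulVec, ladder_mulVec,
    Function.update_of_ne (modeA_ne_modeB _ _), jwSign_modeB,
    jwSign_update_of_le (show modeA i ≤ modeB i by simp [modeA, modeB, Fin.le_def])]
  by_cases h1 : x (modeA i) = 0
  · by_cases h2 : x (modeB i) = 0
    · simp only [h1, h2, and_self, if_true]
      rw [neg_one_mul, neg_mul, ← mul_assoc, jwSign_mul_self, one_mul,
        Function.update_comm (modeA_ne_modeB _ _).symm]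
      rfl
    · simp [h2]
  · simp [h1]

end Sites

section Height

/-- The total weight of the occupied modes of a configuration. -/
def height (w : Fin N → ℤ) (x : Fin N → Fin 2) : ℤ := ∑ j, if x j = 0 then w j else 0

/-- The operator `M` shifts the weight of configurations by `d`. -/
def HasDegree (w : Fin N → ℤ) (d : ℤ) (M : Op N) : Prop :=
  ∀ x y, M x y ≠ 0 → height w x = height w y + d

lemma height_update (w : Fin N → ℤ) (x : Fin N → Fin 2) (j : Fin N) (v : Fin 2) :
    height w (Function.update x j v) + (if x j = 0 then w j else 0) =
      height w x + if v = 0 then w j else 0 := by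
  rw [height, height, ← Finset.add_sum_erase _ _ (Finset.mem_univ j),
    ← Finset.add_sum_erase _ (fun i => if x i = 0 then w i else 0) (Finset.mem_univ j),
    Function.update_self, Finset.sum_congr rfl fun i hi => by
      rw [Function.update_of_ne (Finset.ne_of_mem_erase hi)]]
  ring

lemma hasDegree_cd (w : Fin N → ℤ) (j : Fin N) : HasDegree w (w j) (cd N j) := by
  intro x y h
  rw [cd_eq_ladder, ladder, Matrix.of_apply, ite_ne_right_iff] at h
  obtain ⟨⟨h1, rfl⟩, -⟩ := h
  have := height_update w x j (Fin.rev 0)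
  rw [if_pos h1, if_neg (by decide)] at this
  omega

lemma hasDegree_c (w : Fin N → ℤ) (j : Fin N) : HasDegree w (-w j) (c N j) := by
  intro x y h
  rw [c_eq_ladder, ladder, Matrix.of_apply, ite_ne_right_iff] at h
  obtain ⟨⟨h1, rfl⟩, -⟩ := h
  have := height_update w x j (Fin.rev 1)
  rw [if_neg (by rw [h1]; decide), if_pos (by decide)] at this
  omega

lemma HasDegree.mul {w : Fin N → ℤ} {d d' : ℤ} {M M' : Op N} (h : HasDegree w d M)
    (h' : HasDegree w d' M') : HasDegree w (d + d') (M * M') := by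
  intro x y hxy
  rw [Matrix.mul_apply] at hxy
  obtain ⟨z, -, hz⟩ := Finset.exists_ne_zero_of_sum_ne_zero hxy
  rw [h x z (left_ne_zero_of_mul hz), h' z y (right_ne_zero_of_mul hz)]
  ring

lemma HasDegree.add {w : Fin N → ℤ} {d : ℤ} {M M' : Op N} (h : HasDegree w d M)
    (h' : HasDegree w d M') : HasDegree w d (M + M') := by
  intro x y hxy
  by_cases h0 : M x y = 0
  · exact h' x y fun h1 => hxy (by rw [Matrix.add_apply, h0, h1, add_zero])
  · exact h x y h0

lemma HasDegree.neg {w : Fin N → ℤ} {d : ℤ} {M : Op N} (h : HasDegree w d M) :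
    HasDegree w d (-M) :=
  fun x y hxy => h x y (neg_ne_zero.mp hxy)

/-- A nonzero subspace stable under operators of positive degree contains a nonzero vector
annihilated by all of them. -/
lemma exists_highest (w : Fin N → ℤ) (W : Submodule ℂ (V N)) (hW : W ≠ ⊥) :
    ∃ ψ ∈ W, ψ ≠ 0 ∧ ∀ (d : ℤ) (M : Op N), 0 < d → HasDegree w d M →
      (∀ φ ∈ W, M *ᵥ φ ∈ W) → M *ᵥ ψ = 0 := by
  let P : ℤ → Prop := fun d => ∃ ψ ∈ W, ψ ≠ 0 ∧ ∀ x, ψ x ≠ 0 → d ≤ height w x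
  obtain ⟨lo, hlo⟩ := (Set.finite_range (height w)).bddBelow
  obtain ⟨hi, hhi⟩ := (Set.finite_range (height w)).bddAbove
  obtain ⟨φ, hφ, hφ0⟩ := Submodule.exists_mem_ne_zero_of_ne_bot hW
  have hP : ∃ d, P d := ⟨lo, φ, hφ, hφ0, fun x _ => hlo ⟨x, rfl⟩⟩
  have hbdd : ∀ d, P d → d ≤ hi := by
    rintro d ⟨ψ, -, h0, h⟩
    obtain ⟨x, hx⟩ := Function.ne_iff.mp h0
    exact (h x hx).trans (hhi ⟨x, rfl⟩)
  obtain ⟨d, ⟨ψ, hψ, h0, h⟩, hmax⟩ := Int.exists_greatest_of_bdd ⟨hi, hbdd⟩ hP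
  refine ⟨ψ, hψ, h0, fun t M ht hM hMW => ?_⟩
  by_contra hne
  have : P (d + t) := by
    refine ⟨M *ᵥ ψ, hMW ψ hψ, hne, fun x hx => ?_⟩
    obtain ⟨y, -, hy⟩ := Finset.exists_ne_zero_of_sum_ne_zero hx
    have h1 := hM x y (left_ne_zero_of_mul hy)
    have h2 := h y (right_ne_zero_of_mul hy)
    omega
  have := hmax _ this
  omega

end Height

section Highest

variable {L : ℕ}

/-- The raising operator for the long root attached to `i` and `j`. -/
def raiseLong (i j : Fin L) : Op (2 * L) :=
  cd (2 * L) (modeA i) * c (2 * L) (modeB j) + cd (2 * L) (modeA j) * c (2 * L) (modeB i)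

/-- The root operator moving weight from `j` to `i`. -/
def raiseShort (i j : Fin L) : Op (2 * L) :=
  cd (2 * L) (modeA i) * c (2 * L) (modeA j) - cd (2 * L) (modeB j) * c (2 * L) (modeB i)

/-- Vectors annihilated by all positive root operators. -/
structure IsHighest (ψ : V (2 * L)) : Prop where
  long : ∀ i j, raiseLong i j *ᵥ ψ = 0
  short : ∀ i j, i < j → raiseShort i j *ᵥ ψ = 0

lemma occupied_mulVec (j : Fin (2 * L)) (ψ : V (2 * L)) (x : Fin (2 * L) → Fin 2) :
    ((cd (2 * L) j * c (2 * L) j) *ᵥ ψ) x = if x j = 0 then ψ x else 0 := by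
  rw [cd_mul_c_self, Matrix.mulVec_diagonal, ite_mul, one_mul, zero_mul]

lemma empty_mulVec (j : Fin (2 * L)) (ψ : V (2 * L)) (x : Fin (2 * L) → Fin 2) :
    ((c (2 * L) j * cd (2 * L) j) *ᵥ ψ) x = if x j = 1 then ψ x else 0 := by
  rw [c_mul_cd_self, Matrix.mulVec_diagonal, ite_mul, one_mul, zero_mul]

section Ring

variable {R : Type*} [Ring R] {a b A B : Fin L → R}

lemma mul_mul_of_anticomm {x y : R} (hxy : x * y = -(y * x)) (z : R) :
    x * (y * z) = -(y * (x * z)) := by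
  rw [← mul_assoc, hxy, neg_mul, mul_assoc]

lemma PairedCAR.Aa_of_ne (h : PairedCAR a b A B) {i j : Fin L} (hij : i ≠ j) :
    A i * a j = -(a j * A i) := by
  rw [h.Aa, if_neg hij.symm, zero_sub]

lemma PairedCAR.Bb_of_ne (h : PairedCAR a b A B) {i j : Fin L} (hij : i ≠ j) :
    B i * b j = -(b j * B i) := by
  rw [h.Bb, if_neg hij.symm, zero_sub]

lemma PairedCAR.long_identity (h : PairedCAR a b A B) {i j : Fin L} (hij : i ≠ j) :
    B j * a i * (A i * b j + A j * b i) =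
      a i * A i * (B j * b j) - a i * b i * (B j * A j) := by
  have e1 : B j * a i * (A i * b j) = a i * A i * (B j * b j) := by
    rw [mul_assoc, mul_assoc, mul_mul_of_anticomm (h.Ba j i),
      mul_mul_of_anticomm ((by rw [h.AB, neg_neg] : B j * A i = -(A i * B j))), mul_neg, neg_neg]
  have e2 : B j * a i * (A j * b i) = -(a i * b i * (B j * A j)) := by
    rw [mul_assoc, mul_assoc, mul_mul_of_anticomm (h.Ba j i), h.Ab, mul_neg, mul_neg,
      mul_mul_of_anticomm (h.Bb_of_ne hij.symm), mul_neg, neg_neg]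
  rw [mul_add, e1, e2, sub_eq_add_neg]

lemma PairedCAR.short_identity (h : PairedCAR a b A B) {i j : Fin L} (hij : i ≠ j) :
    A j * a i * (A i * a j - B j * b i) =
      a i * A i * (A j * a j) - B j * A j * (a i * b i) := by
  have e1 : A j * a i * (A i * a j) = a i * A i * (A j * a j) := by
    rw [mul_assoc, mul_assoc, mul_mul_of_anticomm (h.Aa_of_ne hij.symm),
      mul_mul_of_anticomm (h.AA j i), mul_neg, neg_neg]
  have e2 : A j * a i * (B j * b i) = B j * A j * (a i * b i) := by
    rw [mul_assoc, mul_assoc, mul_mul_of_anticomm (h.aB i j), mul_neg,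
      mul_mul_of_anticomm (h.AB j j), neg_neg]
  rw [mul_sub, e1, e2]

lemma PairedCAR.short_identity' (h : PairedCAR a b A B) {i j : Fin L} (hij : i ≠ j) :
    B i * b j * (A i * a j - B j * b i) =
      a j * b j * (B i * A i) - b j * B j * (B i * b i) := by
  have e1 : B i * b j * (A i * a j) = a j * b j * (B i * A i) := by
    rw [mul_assoc, mul_assoc, h.Aa_of_ne hij, mul_neg,
      mul_mul_of_anticomm (by rw [h.ab, neg_neg] : b j * a j = -(a j * b j)), neg_neg,
      mul_mul_of_anticomm (h.Ba i j), mul_mul_of_anticomm (h.Bb_of_ne hij), mul_neg, neg_neg]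
  have e2 : B i * b j * (B j * b i) = b j * B j * (B i * b i) := by
    rw [mul_assoc, mul_assoc, mul_mul_of_anticomm (h.Bb_of_ne hij),
      mul_mul_of_anticomm (h.BB i j), mul_neg, neg_neg]
  rw [mul_sub, e1, e2]

end Ring

namespace IsHighest

variable {ψ : V (2 * L)}

lemma apply_eq_zero_of_down (h : IsHighest ψ) {x : Fin (2 * L) → Fin 2} {i : Fin L} (hA : x
    (modeA i) = 1)
    (hB : x (modeB i) = 0) : ψ x = 0 := by
  have e : c (2 * L) (modeA i) * cd (2 * L) (modeA i) *
      (cd (2 * L) (modeB i) * c (2 * L) (modeB i)) =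
      ((1 : ℂ) / 2) • (cd (2 * L) (modeB i) * c (2 * L) (modeA i) * raiseLong i i) := by
    have hc := pairedCAR_c L
    rw [raiseLong, ← two_smul ℂ, mul_smul_comm, smul_smul, one_div, inv_mul_cancel₀ two_ne_zero,
      one_smul, mul_assoc, mul_assoc, mul_mul_of_anticomm (hc.Ba i i),
      mul_mul_of_anticomm (by rw [hc.AB, neg_neg] : cd (2 * L) (modeB i) * cd (2 * L) (modeA i) =
        -(cd (2 * L) (modeA i) * cd (2 * L) (modeB i))), mul_neg, neg_neg]
  have := congrFun (congrArg (· *ᵥ ψ) e) x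
  beta_reduce at this
  rw [← mulVec_mulVec, empty_mulVec, occupied_mulVec, smul_mulVec, ← mulVec_mulVec, h.long,
    mulVec_zero, smul_zero] at this
  simpa [hA, hB] using this

lemma apply_swap (h : IsHighest ψ) {x : Fin (2 * L) → Fin 2} {i j : Fin L} (hij : i ≠ j)
    (hiA : x (modeA i) = 1) (hiB : x (modeB i) = 1) (hjA : x (modeA j) = 0)
    (hjB : x (modeB j) = 0) : ψ x = ψ (setSite (setSite x i 0) j 1) := by
  have e := (pairedCAR_c L).long_identity hij
  have := congrFun (congrArg (· *ᵥ ψ) e) x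
  beta_reduce at this
  rw [← raiseLong, ← mulVec_mulVec, h.long, mulVec_zero, sub_mulVec, Pi.sub_apply,
    ← mulVec_mulVec, empty_mulVec, occupied_mulVec, ← mulVec_mulVec, lower_mulVec,
    raise_mulVec] at this
  rw [eq_comm, Pi.zero_apply, sub_eq_zero] at this
  simpa [hiA, hiB, hjA, hjB, setSite_modeA, setSite_modeB, hij.symm] using this

lemma up_of_lt (h : IsHighest ψ) {x : Fin (2 * L) → Fin 2} {i j : Fin L} (hij : i < j)
    (hx : ψ x ≠ 0)
    (hjA : x (modeA j) = 0) (hjB : x (modeB j) = 1) :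
    x (modeA i) = 0 ∧ x (modeB i) = 1 := by
  have e1 := congrFun (congrArg (· *ᵥ ψ) ((pairedCAR_c L).short_identity hij.ne)) x
  have e2 := congrFun (congrArg (· *ᵥ ψ) ((pairedCAR_c L).short_identity' hij.ne)) x
  beta_reduce at e1 e2
  rw [← raiseShort, ← mulVec_mulVec, h.short i j hij, mulVec_zero, sub_mulVec, Pi.sub_apply,
    ← mulVec_mulVec, empty_mulVec, occupied_mulVec, ← mulVec_mulVec, raise_mulVec] at e1
  rw [← raiseShort, ← mulVec_mulVec, h.short i j hij, mulVec_zero, sub_mulVec, Pi.sub_apply,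
    ← mulVec_mulVec, lower_mulVec, raise_mulVec, ← mulVec_mulVec, empty_mulVec,
    occupied_mulVec] at e2
  have f1 : x (modeA i) ≠ 1 := fun h1 => hx (by simpa [h1, hjA, hjB] using e1.symm)
  have f2 : x (modeB i) ≠ 0 := fun h1 => hx (by simpa [h1, hjA, hjB] using e2)
  omega

end IsHighest

end Highest

section Types

variable {L : ℕ}

/-- The doubly occupied or down pairs of sites. -/
def filled (x : Fin (2 * L) → Fin 2) : Finset (Fin L) :=
  Finset.univ.filter fun i => x (modeB i) = 0

lemma mem_filled {x : Fin (2 * L) → Fin 2} {i : Fin L} : i ∈ filled x ↔ x (modeB i) = 0 := by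
  simp [filled]

/-- Configurations whose first `k` pairs of sites are spin up and whose remaining pairs are
empty or doubly occupied, exactly `m` of them being doubly occupied. -/
structure IsType (k m : ℕ) (x : Fin (2 * L) → Fin 2) : Prop where
  up : ∀ i : Fin L, (i : ℕ) < k → x (modeA i) = 0 ∧ x (modeB i) = 1
  paired : ∀ i : Fin L, k ≤ i → x (modeA i) = x (modeB i)
  card : (filled x).card = m

lemma filled_setSite_zero (x : Fin (2 * L) → Fin 2) (i : Fin L) :
    filled (setSite x i 0) = insert i (filled x) := by
  ext j
  simp only [mem_filled, setSite_modeB, Finset.mem_insert]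
  split_ifs with h <;> simp [h]

lemma filled_setSite_one (x : Fin (2 * L) → Fin 2) (i : Fin L) :
    filled (setSite x i 1) = (filled x).erase i := by
  ext j
  simp only [mem_filled, setSite_modeB, Finset.mem_erase]
  split_ifs with h <;> simp [h]

variable {k m : ℕ} {x y : Fin (2 * L) → Fin 2}

lemma IsType.le_of_mem (hx : IsType k m x) {i : Fin L} (hi : i ∈ filled x) : k ≤ i := by
  by_contra h
  have := (hx.up i (by omega)).2
  rw [mem_filled] at hi
  omega

lemma IsType.setSite_iff {i : Fin L} (s : Fin 2) (hA : x (modeA i) = x (modeB i)) :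
    IsType k (filled (setSite x i s)).card (setSite x i s) ↔
      IsType k (filled x).card x := by
  constructor
  · intro h
    have hki : k ≤ i := by
      by_contra hlt
      have := h.up i (by omega)
      simp only [setSite_modeA, setSite_modeB, if_true] at this
      omega
    refine ⟨fun j hj => ?_, fun j hj => ?_, rfl⟩
    · have := h.up j hj
      simpa [setSite_modeA, setSite_modeB, show j ≠ i by rintro rfl; omega] using this
    · by_cases hji : j = i
      · rw [hji, hA]
      · simpa [setSite_modeA, setSite_modeB, hji] using h.paired j hj
  · intro h
    have hki : k ≤ i := by
      by_contra hlt
      have := h.up i (by omega)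
      omega
    refine ⟨fun j hj => ?_, fun j hj => ?_, rfl⟩
    · have := h.up j hj
      simpa [setSite_modeA, setSite_modeB, show j ≠ i by rintro rfl; omega] using this
    · by_cases hji : j = i
      · simp [setSite_modeA, setSite_modeB, hji]
      · simpa [setSite_modeA, setSite_modeB, hji] using h.paired j hj

lemma isType_iff : IsType k m x ↔ IsType k (filled x).card x ∧ (filled x).card = m :=
  ⟨fun h => ⟨⟨h.up, h.paired, rfl⟩, h.card⟩, fun h => ⟨h.1.up, h.1.paired, h.2⟩⟩

lemma IsType.eq_of_filled_eq (hx : IsType k m x) (hy : IsType k m y)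
    (h : filled x = filled y) : x = y := by
  have hB : ∀ i, x (modeB i) = y (modeB i) := fun i => by
    have : x (modeB i) = 0 ↔ y (modeB i) = 0 := by rw [← mem_filled, ← mem_filled, h]
    omega
  refine config_ext (fun i => ?_) hB
  rcases lt_or_ge (i : ℕ) k with hi | hi
  · rw [(hx.up i hi).1, (hy.up i hi).1]
  · rw [hx.paired i hi, hy.paired i hi, hB]

lemma IsType.unique {k' m' : ℕ} (hk : k ≤ L) (hk' : k' ≤ L) (hx : IsType k m x)
    (hx' : IsType k' m' x) : (k, m) = (k', m') := by
  have key : ∀ {k m k' m' : ℕ}, k' ≤ L → IsType k m x → IsType k' m' x → ¬ k < k' := by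
    intro k m k' m' hk' hx hx' hlt
    have h1 := hx.paired ⟨k, by omega⟩ le_rfl
    have h2 := hx'.up ⟨k, by omega⟩ hlt
    omega
  have : k = k' := le_antisymm (not_lt.mp (key hk hx' hx)) (not_lt.mp (key hk' hx hx'))
  rw [this, ← hx.card, ← hx'.card]

lemma IsType.add_le (hk : k ≤ L) (hx : IsType k m x) : k + m ≤ L := by
  have h1 : filled x ⊆ Finset.univ.filter fun i : Fin L => ¬ (i : ℕ) < k := fun i hi => by
    simpa using hx.le_of_mem hi
  have h2 := Finset.card_le_card h1
  have h3 := Finset.card_filter_add_card_filter_not (s := (Finset.univ : Finset (Fin L)))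
    (fun i : Fin L => (i : ℕ) < k)
  have h4 : (Finset.univ.filter fun i : Fin L => (i : ℕ) < k).card = k := by
    rw [Fin.card_filter_val_lt, min_eq_right hk]
  rw [hx.card] at h2
  rw [Finset.card_univ, Fintype.card_fin] at h3
  omega

lemma IsHighest.exists_isType {ψ : V (2 * L)} (h : IsHighest ψ) (hx : ψ x ≠ 0) :
    ∃ k ≤ L, IsType k (filled x).card x := by
  let P : ℕ → Prop := fun k => ∀ i : Fin L, k ≤ i → x (modeA i) = x (modeB i)
  have hP : ∃ k, P k := ⟨L, fun i hi => absurd i.2 (by omega)⟩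
  classical
  refine ⟨Nat.find hP, Nat.find_min' hP fun i hi => absurd i.2 (by omega), ⟨?_, Nat.find_spec hP,
    rfl⟩⟩
  intro i hi
  have h1 := Nat.find_min hP (show Nat.find hP - 1 < Nat.find hP by omega)
  simp only [P, not_forall] at h1
  obtain ⟨j, hj, hne⟩ := h1
  have hjA : x (modeA j) = 0 ∧ x (modeB j) = 1 := by
    by_contra hc
    exact hx (h.apply_eq_zero_of_down (i := j) (by omega) (by omega))
  rcases (show i ≤ j by rw [Fin.le_def]; omega).lt_or_eq with hij | rfl
  · exact h.up_of_lt hij hx hjA.1 hjA.2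
  · exact hjA

lemma IsHighest.apply_eq {ψ : V (2 * L)} (h : IsHighest ψ) (hx : IsType k m x)
    (hy : IsType k m y) : ψ x = ψ y := by
  obtain ⟨n, hn⟩ : ∃ n, (filled x \ filled y).card = n := ⟨_, rfl⟩
  induction n generalizing x with
  | zero =>
    rw [Finset.card_eq_zero, Finset.sdiff_eq_empty_iff_subset] at hn
    rw [hx.eq_of_filled_eq hy (Finset.eq_of_subset_of_card_le hn (by rw [hx.card, hy.card]))]
  | succ n ih =>
    have hc : (filled x \ filled y).card = (filled y \ filled x).card :=
      Finset.card_sdiff_comm (by rw [hx.card, hy.card])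
    obtain ⟨j, hj⟩ := Finset.card_pos.mp (show 0 < (filled x \ filled y).card by omega)
    obtain ⟨i, hi⟩ := Finset.card_pos.mp (show 0 < (filled y \ filled x).card by omega)
    rw [Finset.mem_sdiff] at hi hj
    have hij : i ≠ j := fun e => hi.2 (e ▸ hj.1)
    have hki := hy.le_of_mem hi.1
    have hkj := hx.le_of_mem hj.1
    have hiB : x (modeB i) = 1 := by
      have := hi.2
      rw [mem_filled] at this
      omega
    have hjB := mem_filled.mp hj.1
    have hiA := (hx.paired i hki).trans hiB
    have hjA := (hx.paired j hkj).trans hjB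
    rw [h.apply_swap hij hiA hiB hjA hjB]
    have hf : filled (setSite (setSite x i 0) j 1) = (insert i (filled x)).erase j := by
      rw [filled_setSite_one, filled_setSite_zero]
    refine ih ?_ ?_
    · refine isType_iff.mpr ⟨?_, ?_⟩
      · rw [IsType.setSite_iff, IsType.setSite_iff]
        · exact (isType_iff.mp hx).1
        · rw [hiA, hiB]
        · simp [setSite_modeA, setSite_modeB, hij.symm, hjA, hjB]
      · rw [hf, Finset.card_erase_of_mem (Finset.mem_insert_of_mem hj.1),
          Finset.card_insert_of_notMem hi.2, hx.card, Nat.add_sub_cancel]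
    · have : (insert i (filled x)).erase j \ filled y = (filled x \ filled y).erase j := by
        ext l
        simp only [Finset.mem_sdiff, Finset.mem_erase, Finset.mem_insert]
        constructor
        · rintro ⟨⟨h1, rfl | h2⟩, h3⟩
          · exact absurd hi.1 h3
          · exact ⟨h1, h2, h3⟩
        · rintro ⟨h1, h2, h3⟩
          exact ⟨⟨h1, Or.inr h2⟩, h3⟩
      rw [hf, this, Finset.card_erase_of_mem (Finset.mem_sdiff.mpr hj), hn, Nat.add_sub_cancel]

open Classical in
/-- The indicator vector of the configurations of a given type. -/
def typeVec (L k m : ℕ) : V (2 * L) := fun x => if IsType k m x then 1 else 0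

/-- The labels of the nonempty types. -/
def typeLabels (L : ℕ) : Finset (ℕ × ℕ) :=
  (Finset.range (L + 1) ×ˢ Finset.range (L + 1)).filter fun p => p.1 + p.2 ≤ L

lemma mem_typeLabels {p : ℕ × ℕ} : p ∈ typeLabels L ↔ p.1 + p.2 ≤ L := by
  simp only [typeLabels, Finset.mem_filter, Finset.mem_product, Finset.mem_range]
  omega

lemma IsHighest.eq_sum {ψ : V (2 * L)} (h : IsHighest ψ) :
    ∃ γ : ℕ × ℕ → ℂ, ψ = ∑ p ∈ typeLabels L, γ p • typeVec L p.1 p.2 ∧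
      ∀ p ∈ typeLabels L, γ p ≠ 0 → ∃ x, ψ x ≠ 0 ∧ IsType p.1 p.2 x := by
  classical
  refine ⟨fun p => if hp : ∃ x, IsType p.1 p.2 x then ψ hp.choose else 0, ?_, ?_⟩
  · ext x
    rw [Finset.sum_apply]
    by_cases hx : ∃ p ∈ typeLabels L, IsType p.1 p.2 x
    · obtain ⟨p, hp, hxp⟩ := hx
      rw [Finset.sum_eq_single p]
      · have hex : ∃ x : Fin (2 * L) → Fin 2, IsType p.1 p.2 x := ⟨x, hxp⟩
        rw [Pi.smul_apply, typeVec, if_pos hxp, smul_eq_mul, mul_one]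
        beta_reduce
        rw [dif_pos hex]
        exact h.apply_eq hxp hex.choose_spec
      · intro q hq hqp
        rw [Pi.smul_apply, typeVec, if_neg, smul_zero]
        rw [mem_typeLabels] at hp hq
        exact fun hc => hqp (IsType.unique (by omega) (by omega) hc hxp)
      · exact fun hn => absurd hp hn
    · rw [Finset.sum_eq_zero]
      · by_contra hne
        obtain ⟨k, hk, hkx⟩ := h.exists_isType hne
        exact hx ⟨(k, _), mem_typeLabels.mpr (hkx.add_le hk), hkx⟩
      · intro p hp
        rw [Pi.smul_apply, typeVec, if_neg (fun hc => hx ⟨p, hp, hc⟩), smul_zero]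
  · intro p _ hne
    beta_reduce at hne
    split_ifs at hne with hp
    · exact ⟨_, hne, hp.choose_spec⟩
    · exact absurd rfl hne

end Types

section TypeVectors

variable {L : ℕ} {k m : ℕ}

/-- The pair creation operator of the spin chain. -/
def chainRaise (L : ℕ) : Op (2 * L) :=
  pairRaise (fun k : Fin L => cd (2 * L) (modeA k)) fun k => cd (2 * L) (modeB k)

/-- The pair annihilation operator of the spin chain. -/
def chainLower (L : ℕ) : Op (2 * L) :=
  pairLower (fun k : Fin L => c (2 * L) (modeA k)) fun k => c (2 * L) (modeB k)

lemma typeVec_of_not {x : Fin (2 * L) → Fin 2} (h : ¬ IsType k m x) : typeVec L k m x = 0 :=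
  if_neg h

open Classical in
lemma chainRaise_typeVec (L k m : ℕ) :
    chainRaise L *ᵥ typeVec L k m = -((m : ℂ) + 1) • typeVec L k (m + 1) := by
  ext x
  rw [chainRaise, pairRaise, sum_mulVec, Finset.sum_apply]
  simp only [raise_mulVec, Pi.smul_apply]
  have key : ∀ i : Fin L, (if x (modeA i) = 0 ∧ x (modeB i) = 0
      then -typeVec L k m (setSite x i 1) else 0) =
      if i ∈ filled x then (if IsType k (m + 1) x then -1 else 0) else 0 := fun i => by
    by_cases hB : x (modeB i) = 0
    · have hi : i ∈ filled x := mem_filled.mpr hB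
      rw [if_pos hi]
      by_cases hA : x (modeA i) = 0
      · have : IsType k m (setSite x i 1) ↔ IsType k (m + 1) x := by
          rw [isType_iff, IsType.setSite_iff _ (hA.trans hB.symm), isType_iff (m := m + 1),
            filled_setSite_one, Finset.card_erase_of_mem hi]
          have := Finset.card_pos.mpr ⟨i, hi⟩
          refine and_congr_right fun _ => ?_
          omega
        rw [if_pos ⟨hA, hB⟩, typeVec, apply_ite Neg.neg, neg_zero]
        simp only [this]
      · rw [if_neg (fun h => hA h.1), if_neg]
        intro h
        exact hA ((h.paired i (h.le_of_mem hi)).trans hB)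
    · rw [if_neg (fun h => hB h.2), if_neg (fun h => hB (mem_filled.mp h))]
  rw [Finset.sum_congr rfl fun i _ => key i, Finset.sum_ite_mem, Finset.univ_inter,
    Finset.sum_const, typeVec, nsmul_eq_mul]
  split_ifs with h
  · rw [h.card]; simp
  · simp

open Classical in
lemma chainLower_typeVec_succ (hk : k ≤ L) (m : ℕ) :
    chainLower L *ᵥ typeVec L k (m + 1) = -((L : ℂ) - k - m) • typeVec L k m := by
  ext x
  rw [chainLower, pairLower, sum_mulVec, Finset.sum_apply]
  simp only [lower_mulVec, Pi.smul_apply]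
  have key : ∀ i : Fin L, (if x (modeA i) = 1 ∧ x (modeB i) = 1
      then -typeVec L k (m + 1) (setSite x i 0) else 0) =
      if k ≤ i ∧ i ∉ filled x then (if IsType k m x then -1 else 0) else 0 := fun i => by
    by_cases hB : x (modeB i) = 1
    · have hi : i ∉ filled x := fun h => by rw [mem_filled] at h; omega
      by_cases hA : x (modeA i) = 1
      · have : IsType k (m + 1) (setSite x i 0) ↔ IsType k m x := by
          rw [isType_iff, IsType.setSite_iff _ (hA.trans hB.symm), isType_iff (m := m),
            filled_setSite_zero, Finset.card_insert_of_notMem hi, Nat.add_right_cancel_iff]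
        rw [if_pos ⟨hA, hB⟩, typeVec, apply_ite Neg.neg, neg_zero]
        simp only [this]
        by_cases ht : IsType k m x
        · rw [if_pos ht, if_pos]
          refine ⟨?_, hi⟩
          by_contra hlt
          have := (ht.up i (by omega)).1
          omega
        · rw [if_neg ht, ite_self]
      · rw [if_neg (fun h => hA h.1), ← ite_and, if_neg]
        rintro ⟨⟨h1, -⟩, h⟩
        exact hA ((h.paired i h1).trans hB)
    · rw [if_neg (fun h => hB h.2), if_neg (fun h => h.2 (mem_filled.mpr (by omega)))]
  rw [Finset.sum_congr rfl fun i _ => key i, ← Finset.sum_filter, Finset.sum_const, typeVec,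
    nsmul_eq_mul]
  split_ifs with h
  · have h1 : Finset.univ.filter (fun i : Fin L => k ≤ i ∧ i ∉ filled x) =
        (Finset.univ.filter fun i : Fin L => ¬ (i : ℕ) < k) \ filled x := by
      ext i
      simp
    have h2 : filled x ⊆ Finset.univ.filter fun i : Fin L => ¬ (i : ℕ) < k := fun i hi => by
      simpa using h.le_of_mem hi
    have h3 := Finset.card_filter_add_card_filter_not (s := (Finset.univ : Finset (Fin L)))
      (fun i : Fin L => (i : ℕ) < k)
    have h4 : (Finset.univ.filter fun i : Fin L => (i : ℕ) < k).card = k := by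
      rw [Fin.card_filter_val_lt, min_eq_right hk]
    have h5 := h.add_le hk
    rw [Finset.card_univ, Fintype.card_fin] at h3
    rw [h1, Finset.card_sdiff_of_subset h2, h.card,
      show (Finset.univ.filter fun i : Fin L => ¬ (i : ℕ) < k).card = L - k by omega,
      Nat.cast_sub (by omega), Nat.cast_sub hk]
    simp
  · simp

lemma chainLower_typeVec_zero (L k : ℕ) : chainLower L *ᵥ typeVec L k 0 = 0 := by
  ext x
  rw [chainLower, pairLower, sum_mulVec, Finset.sum_apply]
  refine Finset.sum_eq_zero fun i _ => ?_
  rw [lower_mulVec, typeVec_of_not, neg_zero, ite_self]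
  intro h
  have := h.card
  rw [filled_setSite_zero, Finset.card_eq_zero] at this
  exact Finset.insert_ne_empty _ _ this

lemma raiseLong_eq (i j : Fin L) : raiseLong i j =
    c (2 * L) (modeB i) * -cd (2 * L) (modeA j) + c (2 * L) (modeB j) * -cd (2 * L) (modeA i) := by
  have h := pairedCAR_c L
  rw [raiseLong, mul_neg, mul_neg, h.bA, h.bA, neg_neg, neg_neg, add_comm]

lemma raiseShort_eq (i j : Fin L) : raiseShort i j =
    c (2 * L) (modeA j) * -cd (2 * L) (modeA i) + c (2 * L) (modeB i) * cd (2 * L) (modeB j) := by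
  have h := pairedCAR_c L
  rw [raiseShort, mul_neg, h.aA, h.bB]
  by_cases hij : i = j
  · subst hij
    simp
  · simp [hij, Ne.symm hij]
    abel

lemma chainRaise_commute_raiseLong (i j : Fin L) : Commute (chainRaise L) (raiseLong i j) := by
  have := (pairedCAR_c L).pairRaise_commute_bilinear (mk_b_mem_modeSpan i) (mk_b_mem_modeSpan j)
  rwa [← raiseLong_eq] at this

lemma chainRaise_commute_raiseShort (i j : Fin L) : Commute (chainRaise L) (raiseShort i j) := by
  have := (pairedCAR_c L).pairRaise_commute_bilinear (mk_a_mem_modeSpan j) (mk_b_mem_modeSpan i)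
  rwa [← raiseShort_eq] at this

lemma IsHighest.mulVec {ψ : V (2 * L)} (h : IsHighest ψ) {X : Op (2 * L)}
    (hl : ∀ i j : Fin L, Commute X (raiseLong i j))
    (hs : ∀ i j : Fin L, Commute X (raiseShort i j)) : IsHighest (X *ᵥ ψ) where
  long i j := by rw [mulVec_mulVec, ← (hl i j).eq, ← mulVec_mulVec, h.long, mulVec_zero]
  short i j hij := by
    rw [mulVec_mulVec, ← (hs i j).eq, ← mulVec_mulVec, h.short i j hij, mulVec_zero]

lemma isHighest_typeVec_zero (L k : ℕ) : IsHighest (typeVec L k 0) := by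
  have hb : ∀ j : Fin L, c (2 * L) (modeB j) *ᵥ typeVec L k 0 = 0 := fun j => by
    ext x
    rw [c_eq_ladder, ladder_mulVec, typeVec_of_not, mul_zero, ite_self, Pi.zero_apply]
    intro h
    have := h.card
    rw [Finset.card_eq_zero] at this
    exact Finset.notMem_empty j (this ▸ mem_filled.mpr (by simp))
  have ha : ∀ j : Fin L, k ≤ j → c (2 * L) (modeA j) *ᵥ typeVec L k 0 = 0 := fun j hj => by
    ext x
    rw [c_eq_ladder, ladder_mulVec, typeVec_of_not, mul_zero, ite_self, Pi.zero_apply]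
    intro h
    have := h.card
    rw [Finset.card_eq_zero] at this
    refine Finset.notMem_empty j (this ▸ mem_filled.mpr ?_)
    rw [← h.paired j hj]
    simp
  have hA : ∀ i : Fin L, (i : ℕ) < k → cd (2 * L) (modeA i) *ᵥ typeVec L k 0 = 0 := fun i hi => by
    ext x
    rw [cd_eq_ladder, ladder_mulVec, typeVec_of_not, mul_zero, ite_self, Pi.zero_apply]
    intro h
    simpa using (h.up i hi).1
  refine ⟨fun i j => ?_, fun i j hij => ?_⟩
  · rw [raiseLong, add_mulVec, ← mulVec_mulVec, ← mulVec_mulVec, hb, hb, mulVec_zero, mulVec_zero,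
      add_zero]
  · rw [raiseShort, sub_mulVec, ← mulVec_mulVec _ (cd (2 * L) (modeB j)), hb, mulVec_zero, sub_zero]
    rcases lt_or_ge (j : ℕ) k with hj | hj
    · have := (pairedCAR_c L).Aa_of_ne hij.ne
      beta_reduce at this
      rw [this, neg_mulVec, ← mulVec_mulVec, hA i (lt_trans hij hj), mulVec_zero, neg_zero]
    · rw [← mulVec_mulVec, ha j hj, mulVec_zero]

lemma isHighest_typeVec (L k m : ℕ) : IsHighest (typeVec L k m) := by
  induction m with
  | zero => exact isHighest_typeVec_zero L k
  | succ m ih =>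
    have h := ih.mulVec chainRaise_commute_raiseLong chainRaise_commute_raiseShort
    rw [chainRaise_typeVec] at h
    have hm : -((m : ℂ) + 1) ≠ 0 := neg_ne_zero.mpr (Nat.cast_add_one_ne_zero m)
    refine ⟨fun i j => ?_, fun i j hij => ?_⟩
    · have := h.long i j
      rwa [mulVec_smul, smul_eq_zero_iff_right hm] at this
    · have := h.short i j hij
      rwa [mulVec_smul, smul_eq_zero_iff_right hm] at this

end TypeVectors

section Core

variable {L : ℕ} {k m : ℕ}

/-- Operators commuting with all root operators. -/
structure RootCommute (X : Op (2 * L)) : Prop where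
  long : ∀ i j : Fin L, Commute X (raiseLong i j)
  long' : ∀ i j : Fin L, Commute X (raiseLong i j)ᴴ
  short : ∀ i j : Fin L, Commute X (raiseShort i j)

lemma c_conjTranspose (j : Fin N) : (c N j)ᴴ = cd N j := by
  rw [c_eq_ladder, cd_eq_ladder, ladder_conjTranspose]
  rfl

lemma cd_conjTranspose (j : Fin N) : (cd N j)ᴴ = c N j := by
  rw [← c_conjTranspose, conjTranspose_conjTranspose]

lemma raiseLong_conjTranspose (i j : Fin L) : (raiseLong i j)ᴴ =
    -(c (2 * L) (modeA i) * cd (2 * L) (modeB j) + c (2 * L) (modeA j) * cd (2 * L) (modeB i)) := by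
  have h := pairedCAR_c L
  rw [raiseLong, conjTranspose_add, conjTranspose_mul, conjTranspose_mul, cd_conjTranspose,
    cd_conjTranspose, c_conjTranspose, c_conjTranspose, h.aB, h.aB]
  abel

lemma raiseShort_conjTranspose (i j : Fin L) : (raiseShort i j)ᴴ = raiseShort j i := by
  rw [raiseShort, raiseShort, conjTranspose_sub, conjTranspose_mul, conjTranspose_mul,
    cd_conjTranspose, cd_conjTranspose, c_conjTranspose, c_conjTranspose]

lemma commute_conjTranspose {X M : Op N} (h : Commute X M) : Commute Xᴴ Mᴴ := by
  rw [Commute, SemiconjBy, ← conjTranspose_mul, ← conjTranspose_mul, h.eq]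

lemma RootCommute.conjTranspose {X : Op (2 * L)} (h : RootCommute X) : RootCommute Xᴴ where
  long i j := by simpa using commute_conjTranspose (h.long' i j)
  long' i j := commute_conjTranspose (h.long i j)
  short i j := by simpa [raiseShort_conjTranspose] using commute_conjTranspose (h.short j i)

lemma RootCommute.sub {X Y : Op (2 * L)} (h : RootCommute X) (h' : RootCommute Y) :
    RootCommute (X - Y) where
  long i j := (h.long i j).sub_left (h'.long i j)
  long' i j := (h.long' i j).sub_left (h'.long' i j)
  short i j := (h.short i j).sub_left (h'.short i j)

/-- Operators commuting with all polarised bilinears in the modes commute with the root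
operators. -/
lemma rootCommute_of_bilinear {X : Op (2 * L)}
    (hX : ∀ p q, p ∈ modeSpan (fun k : Fin L => c (2 * L) (modeA k)) (fun k => c (2 * L) (modeB k))
        (fun k => cd (2 * L) (modeA k)) (fun k => cd (2 * L) (modeB k)) →
      q ∈ modeSpan (fun k : Fin L => c (2 * L) (modeA k)) (fun k => c (2 * L) (modeB k))
        (fun k => cd (2 * L) (modeA k)) (fun k => cd (2 * L) (modeB k)) →
      Commute X (p.1 * q.2 + q.1 * p.2)) : RootCommute X where
  long i j := by
    have := hX _ _ (mk_b_mem_modeSpan i) (mk_b_mem_modeSpan j)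
    rwa [← raiseLong_eq] at this
  long' i j := by
    have := (hX _ _ (mk_a_mem_modeSpan i) (mk_a_mem_modeSpan j)).neg_right
    rwa [← raiseLong_conjTranspose] at this
  short i j := by
    have := hX _ _ (mk_a_mem_modeSpan j) (mk_b_mem_modeSpan i)
    rwa [← raiseShort_eq] at this

lemma rootCommute_chainRaise (L : ℕ) : RootCommute (chainRaise L) :=
  rootCommute_of_bilinear fun _ _ => (pairedCAR_c L).pairRaise_commute_bilinear

lemma rootCommute_chainLower (L : ℕ) : RootCommute (chainLower L) :=
  rootCommute_of_bilinear fun _ _ => (pairedCAR_c L).pairLower_commute_bilinear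

lemma rootCommute_of_mem_adjoin {g : Op (2 * L)}
    (hg : g ∈ Algebra.adjoin ℂ {chainLower L, chainRaise L}) : RootCommute g := by
  have key : ∀ M : Op (2 * L), Commute (chainRaise L) M → Commute (chainLower L) M →
      Commute g M := fun M h1 h2 => by
    have : Algebra.adjoin ℂ {chainLower L, chainRaise L} ≤ Subalgebra.centralizer ℂ {M} := by
      refine Algebra.adjoin_le ?_
      rintro _ (rfl | rfl)
      · exact Subalgebra.mem_centralizer_iff ℂ |>.mpr (by rintro _ rfl; exact h2.eq.symm)
      · exact Subalgebra.mem_centralizer_iff ℂ |>.mpr (by rintro _ rfl; exact h1.eq.symm)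
    exact (Subalgebra.mem_centralizer_iff ℂ |>.mp (this hg) M rfl).symm
  have hr := rootCommute_chainRaise L
  have hl := rootCommute_chainLower L
  exact ⟨fun i j => key _ (hr.long i j) (hl.long i j), fun i j => key _ (hr.long' i j)
    (hl.long' i j), fun i j => key _ (hr.short i j) (hl.short i j)⟩

lemma raiseShort_self_mulVec (i : Fin L) (ψ : V (2 * L)) (x : Fin (2 * L) → Fin 2) :
    (raiseShort i i *ᵥ ψ) x =
      ((if x (modeA i) = 0 then 1 else 0) - if x (modeB i) = 0 then 1 else 0) * ψ x := by
  rw [raiseShort, sub_mulVec, Pi.sub_apply, occupied_mulVec, occupied_mulVec]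
  split_ifs <;> simp

lemma IsType.weight {x : Fin (2 * L) → Fin 2} (h : IsType k m x) (i : Fin L) :
    ((if x (modeA i) = 0 then 1 else 0) - if x (modeB i) = 0 then 1 else 0 : ℂ) =
      if (i : ℕ) < k then 1 else 0 := by
  rcases lt_or_ge (i : ℕ) k with hi | hi
  · simp [h.up i hi, hi]
  · simp [h.paired i hi, hi.not_gt]

lemma raiseShort_self_typeVec (i : Fin L) :
    raiseShort i i *ᵥ typeVec L k m = (if (i : ℕ) < k then (1 : ℂ) else 0) • typeVec L k m := by
  ext x
  rw [raiseShort_self_mulVec, Pi.smul_apply, smul_eq_mul]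
  by_cases h : IsType k m x
  · rw [h.weight]
  · rw [typeVec_of_not h, mul_zero, mul_zero]

lemma exists_lower_typeVec (hk : k + m ≤ L) :
    ∃ g ∈ Algebra.adjoin ℂ {chainLower L, chainRaise L},
      g *ᵥ typeVec L k m = typeVec L k 0 := by
  induction m with
  | zero => exact ⟨1, one_mem _, one_mulVec _⟩
  | succ m ih =>
    obtain ⟨g, hg, h⟩ := ih (by omega)
    refine ⟨(-((L : ℂ) - k - m))⁻¹ • (g * chainLower L), Subalgebra.smul_mem _
      (mul_mem hg (Algebra.subset_adjoin (by simp))) _, ?_⟩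
    have h0 : -((L : ℂ) - k - m) ≠ 0 := by
      rw [neg_ne_zero, sub_sub, sub_ne_zero]
      norm_cast
      omega
    rw [smul_mulVec, ← mulVec_mulVec, chainLower_typeVec_succ (by omega), mulVec_smul, h,
      inv_smul_smul₀ h0]

lemma exists_raise_typeVec (L k m : ℕ) :
    ∃ g ∈ Algebra.adjoin ℂ {chainLower L, chainRaise L},
      g *ᵥ typeVec L k 0 = typeVec L k m := by
  induction m with
  | zero => exact ⟨1, one_mem _, one_mulVec _⟩
  | succ m ih =>
    obtain ⟨g, hg, h⟩ := ih
    refine ⟨(-((m : ℂ) + 1))⁻¹ • (chainRaise L * g), Subalgebra.smul_mem _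
      (mul_mem (Algebra.subset_adjoin (by simp)) hg) _, ?_⟩
    rw [smul_mulVec, ← mulVec_mulVec, h, chainRaise_typeVec,
      inv_smul_smul₀ (neg_ne_zero.mpr (Nat.cast_add_one_ne_zero m))]

lemma chainLower_chainRaise_typeVec (hk : k ≤ L) :
    (chainLower L * chainRaise L) *ᵥ typeVec L k m =
      (((m : ℂ) + 1) * (L - k - m)) • typeVec L k m := by
  rw [← mulVec_mulVec, chainRaise_typeVec, mulVec_smul, chainLower_typeVec_succ hk, smul_smul,
    neg_mul_neg]

lemma chainRaise_chainLower_typeVec (hk : k ≤ L) :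
    (chainRaise L * chainLower L) *ᵥ typeVec L k m =
      ((m : ℂ) * (L - k - m + 1)) • typeVec L k m := by
  cases m with
  | zero => simp [← mulVec_mulVec, chainLower_typeVec_zero]
  | succ m =>
    rw [← mulVec_mulVec, chainLower_typeVec_succ hk, mulVec_smul, chainRaise_typeVec, smul_smul,
      neg_mul_neg]
    congr 1
    push_cast
    ring

lemma typeLabels_separated {p q : ℕ × ℕ} (hp : p ∈ typeLabels L) (hq : q ∈ typeLabels L)
    (h1 : ((p.2 : ℂ) + 1) * (L - p.1 - p.2) = ((q.2 : ℂ) + 1) * (L - q.1 - q.2))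
    (h2 : (p.2 : ℂ) * (L - p.1 - p.2 + 1) = (q.2 : ℂ) * (L - q.1 - q.2 + 1)) : p = q := by
  rw [mem_typeLabels] at hp hq
  obtain ⟨k, m⟩ := p
  obtain ⟨k', m'⟩ := q
  simp only at h1 h2 hp hq
  have e1 : ((m : ℤ) + 1) * (L - k - m) = ((m' : ℤ) + 1) * (L - k' - m') := by exact_mod_cast h1
  have e2 : (m : ℤ) * (L - k - m + 1) = (m' : ℤ) * (L - k' - m' + 1) := by exact_mod_cast h2
  have e3 : (L : ℤ) - k - 2 * m = L - k' - 2 * m' := by linarith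
  have e4 : ((m : ℤ) - m') * ((L - k - m) + m' + 1) = 0 := by
    have : (k' : ℤ) = k + 2 * m - 2 * m' := by linarith
    rw [this] at e2
    linarith
  rcases mul_eq_zero.mp e4 with h | h
  · rw [Prod.mk.injEq]
    omega
  · omega

lemma exists_separating {p q : ℕ × ℕ} (hp : p ∈ typeLabels L) (hq : q ∈ typeLabels L)
    (hpq : p ≠ q) : ∃ Q ∈ Algebra.adjoin ℂ {chainLower L, chainRaise L},
      Q *ᵥ typeVec L p.1 p.2 = typeVec L p.1 p.2 ∧ Q *ᵥ typeVec L q.1 q.2 = 0 ∧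
      ∀ r ∈ typeLabels L, ∃ t : ℂ, Q *ᵥ typeVec L r.1 r.2 = t • typeVec L r.1 r.2 := by
  have key : ∀ (M : Op (2 * L)) (μ : ℕ × ℕ → ℂ),
      M ∈ Algebra.adjoin ℂ {chainLower L, chainRaise L} →
      (∀ r ∈ typeLabels L, M *ᵥ typeVec L r.1 r.2 = μ r • typeVec L r.1 r.2) → μ p ≠ μ q →
      ∃ Q ∈ Algebra.adjoin ℂ {chainLower L, chainRaise L},
        Q *ᵥ typeVec L p.1 p.2 = typeVec L p.1 p.2 ∧ Q *ᵥ typeVec L q.1 q.2 = 0 ∧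
        ∀ r ∈ typeLabels L, ∃ t : ℂ, Q *ᵥ typeVec L r.1 r.2 = t • typeVec L r.1 r.2 := by
    intro M μ hM hμ hne
    have hQ : ∀ r ∈ typeLabels L, ((μ p - μ q)⁻¹ • (M - μ q • (1 : Op (2 * L)))) *ᵥ
        typeVec L r.1 r.2 = ((μ p - μ q)⁻¹ * (μ r - μ q)) • typeVec L r.1 r.2 := fun r hr => by
      rw [smul_mulVec, sub_mulVec, hμ r hr, smul_mulVec, one_mulVec, ← sub_smul, smul_smul]
    refine ⟨_, Subalgebra.smul_mem _ (sub_mem hM (Subalgebra.smul_mem _ (one_mem _) (μ q)))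
      (μ p - μ q)⁻¹, ?_, ?_, fun r hr => ⟨_, hQ r hr⟩⟩
    · rw [hQ p hp, inv_mul_cancel₀ (sub_ne_zero.mpr hne), one_smul]
    · rw [hQ q hq, sub_self, mul_zero, zero_smul]
  have hle : ∀ r ∈ typeLabels L, r.1 ≤ L := fun r hr => by
    rw [mem_typeLabels] at hr
    omega
  have hE : chainRaise L ∈ Algebra.adjoin ℂ {chainLower L, chainRaise L} :=
    Algebra.subset_adjoin (by simp)
  have hF : chainLower L ∈ Algebra.adjoin ℂ {chainLower L, chainRaise L} :=
    Algebra.subset_adjoin (by simp)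
  by_cases h1 : ((p.2 : ℂ) + 1) * (L - p.1 - p.2) = ((q.2 : ℂ) + 1) * (L - q.1 - q.2)
  · exact key _ (fun r => (r.2 : ℂ) * (L - r.1 - r.2 + 1)) (mul_mem hE hF)
      (fun r hr => chainRaise_chainLower_typeVec (hle r hr))
      fun h2 => hpq (typeLabels_separated hp hq h1 h2)
  · exact key _ (fun r => ((r.2 : ℂ) + 1) * (L - r.1 - r.2)) (mul_mem hF hE)
      (fun r hr => chainLower_chainRaise_typeVec (hle r hr)) h1

lemma RootCommute.exists_mem_adjoin_typeVec {X : Op (2 * L)} (hX : RootCommute X) {p : ℕ × ℕ}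
    (hp : p ∈ typeLabels L) : ∃ g ∈ Algebra.adjoin ℂ {chainLower L, chainRaise L},
      g *ᵥ typeVec L p.1 p.2 = X *ᵥ typeVec L p.1 p.2 := by
  obtain ⟨γ, hγ, hne⟩ := ((isHighest_typeVec L p.1 p.2).mulVec hX.long hX.short).eq_sum
  have hg : ∀ q ∈ typeLabels L, ∃ g ∈ Algebra.adjoin ℂ {chainLower L, chainRaise L},
      g *ᵥ typeVec L p.1 p.2 = γ q • typeVec L q.1 q.2 := by
    intro q hq
    by_cases h0 : γ q = 0
    · exact ⟨0, zero_mem _, by rw [h0, zero_smul, zero_mulVec]⟩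
    · obtain ⟨x, hx, hxq⟩ := hne q hq h0
      have hk : p.1 = q.1 := by
        have hw : ∀ i : Fin L, (i : ℕ) < p.1 ↔ (i : ℕ) < q.1 := fun i => by
          have e : raiseShort i i *ᵥ X *ᵥ typeVec L p.1 p.2 =
              (if (i : ℕ) < p.1 then (1 : ℂ) else 0) • (X *ᵥ typeVec L p.1 p.2) := by
            rw [mulVec_mulVec, ← (hX.short i i).eq, ← mulVec_mulVec, raiseShort_self_typeVec,
              mulVec_smul]
          have e' := congrFun e x
          rw [raiseShort_self_mulVec, hxq.weight, Pi.smul_apply, smul_eq_mul] at e'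
          have e'' := mul_right_cancel₀ hx e'
          by_cases h1 : (i : ℕ) < p.1 <;> by_cases h2 : (i : ℕ) < q.1 <;> simp [h1, h2] at e'' ⊢
        rw [mem_typeLabels] at hp hq
        by_contra hne
        rcases Nat.lt_or_gt_of_ne hne with hlt | hlt
        · have := hw ⟨p.1, by omega⟩
          simp only at this
          omega
        · have := hw ⟨q.1, by omega⟩
          simp only at this
          omega
      obtain ⟨g1, hg1, h1⟩ := exists_lower_typeVec (mem_typeLabels.mp hp)
      obtain ⟨g2, hg2, h2⟩ := exists_raise_typeVec L p.1 q.2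
      exact ⟨γ q • (g2 * g1), Subalgebra.smul_mem _ (mul_mem hg2 hg1) _, by
        rw [smul_mulVec, ← mulVec_mulVec, h1, h2, hk]⟩
  choose! g hg hgp using hg
  exact ⟨∑ q ∈ typeLabels L, g q, sum_mem hg, by
    rw [hγ, sum_mulVec, Finset.sum_congr rfl hgp]⟩

lemma IsHighest.mulVec_eq_zero {ψ : V (2 * L)} (h : IsHighest ψ) {Y : Op (2 * L)}
    (hY : ∀ p ∈ typeLabels L, Y *ᵥ typeVec L p.1 p.2 = 0) : Y *ᵥ ψ = 0 := by
  obtain ⟨γ, hγ, -⟩ := h.eq_sum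
  rw [hγ, mulVec_sum]
  exact Finset.sum_eq_zero fun p hp => by rw [mulVec_smul, hY p hp, smul_zero]

lemma RootCommute.exists_isHighest {X : Op (2 * L)} (hX : RootCommute X) (h0 : X ≠ 0) :
    ∃ φ, X *ᵥ φ ≠ 0 ∧ IsHighest (X *ᵥ φ) := by
  let w : Fin (2 * L) → ℤ := fun j =>
    if (j : ℕ) % 2 = 0 then L - ((j : ℕ) / 2 : ℕ) else ((j : ℕ) / 2 : ℕ) - L
  have hA : ∀ i : Fin L, w (modeA i) = L - (i : ℕ) := fun i => by simp [w, modeA]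
  have hB : ∀ i : Fin L, w (modeB i) = (i : ℕ) - L := fun i => by
    simp only [w, modeB]
    rw [if_neg (by omega)]
    omega
  have hW : LinearMap.range X.mulVecLin ≠ ⊥ := by
    rw [Ne, LinearMap.range_eq_bot]
    intro h
    refine h0 (Matrix.mulVec_injective (funext fun v => ?_))
    rw [zero_mulVec]
    exact congrArg (fun T : V (2 * L) →ₗ[ℂ] V (2 * L) => T v) h
  have hstab : ∀ M : Op (2 * L), Commute X M → ∀ φ ∈ LinearMap.range X.mulVecLin,
      M *ᵥ φ ∈ LinearMap.range X.mulVecLin := by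
    rintro M hM _ ⟨φ, rfl⟩
    exact ⟨M *ᵥ φ, by rw [mulVecLin_apply, mulVecLin_apply, mulVec_mulVec, mulVec_mulVec, hM.eq]⟩
  obtain ⟨_, ⟨φ, rfl⟩, hne, hhi⟩ := exists_highest w _ hW
  refine ⟨φ, hne, ⟨fun i j => ?_, fun i j hij => ?_⟩⟩
  · refine hhi (2 * L - i - j) _ (by omega) ?_ (hstab _ (hX.long i j))
    have h1 := (hasDegree_cd w (modeA i)).mul (hasDegree_c w (modeB j))
    have h2 := (hasDegree_cd w (modeA j)).mul (hasDegree_c w (modeB i))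
    rw [hA, hB, show (L - (i : ℕ) + -((j : ℕ) - L) : ℤ) = 2 * L - i - j by ring] at h1
    rw [hA, hB, show (L - (j : ℕ) + -((i : ℕ) - L) : ℤ) = 2 * L - i - j by ring] at h2
    exact h1.add h2
  · refine hhi (j - i) _ (by have := Fin.lt_def.mp hij; omega) ?_ (hstab _ (hX.short i j))
    have h1 := (hasDegree_cd w (modeA i)).mul (hasDegree_c w (modeA j))
    have h2 := ((hasDegree_cd w (modeB j)).mul (hasDegree_c w (modeB i))).neg
    rw [hA, hA, show (L - (i : ℕ) + -(L - (j : ℕ)) : ℤ) = j - i by ring] at h1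
    rw [hB, hB, show ((j : ℕ) - L + -((i : ℕ) - L) : ℤ) = j - i by ring] at h2
    rw [raiseShort, sub_eq_add_neg]
    exact h1.add h2

open scoped ComplexOrder in
/-- The commutant of the root operators is generated by the pair creation and annihilation
operators. -/
lemma RootCommute.mem_adjoin {X : Op (2 * L)} (hX : RootCommute X) :
    X ∈ Algebra.adjoin ℂ {chainLower L, chainRaise L} := by
  obtain ⟨g, hg, hgX⟩ := exists_mem_mulVec_eq (Algebra.adjoin ℂ {chainLower L, chainRaise L})
    (typeLabels L) (fun p => typeVec L p.1 p.2) (fun p hp q hq => exists_separating hp hq) X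
    fun p hp => hX.exists_mem_adjoin_typeVec hp
  have hY := hX.sub (rootCommute_of_mem_adjoin hg)
  have hY0 : ∀ p ∈ typeLabels L, (X - g) *ᵥ typeVec L p.1 p.2 = 0 := fun p hp => by
    rw [sub_mulVec, hgX p hp, sub_self]
  suffices h : X - g = 0 by rwa [sub_eq_zero.mp h]
  by_contra hne
  obtain ⟨φ, hφ, hhi⟩ := hY.conjTranspose.exists_isHighest
    (by simpa only [ne_eq, conjTranspose_eq_zero] using hne)
  have := hhi.mulVec_eq_zero hY0
  rw [mulVec_mulVec, self_mul_conjTranspose_mulVec_eq_zero] at this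
  exact hφ this

end Core

section Gauge

/-- The unit `G` implements the linear change of fermionic modes given by the matrix `M`. -/
structure ImplementsModeChange (M : Matrix (Fin N) (Fin N) ℂ) (G : (Op N)ˣ) : Prop where
  cd : ∀ j, (G : Op N) * cd N j = (∑ i, M i j • cd N i) * G
  c : ∀ i, c N i * (G : Op N) = G * ∑ j, M i j • c N j

lemma ImplementsModeChange.mul {M M' : Matrix (Fin N) (Fin N) ℂ} {G G' : (Op N)ˣ}
    (h : ImplementsModeChange M G) (h' : ImplementsModeChange M' G') :
    ImplementsModeChange (M * M') (G * G') where
  cd j := by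
    rw [Units.val_mul, mul_assoc, h'.cd, ← mul_assoc, ← mul_assoc, Finset.mul_sum]
    congr 1
    simp_rw [mul_smul_comm, h.cd, ← smul_mul_assoc, ← Finset.sum_mul, Finset.smul_sum, smul_smul,
      Matrix.mul_apply, Finset.sum_smul]
    rw [Finset.sum_comm]
    simp_rw [mul_comm]
  c i := by
    rw [Units.val_mul, ← mul_assoc, h.c, mul_assoc, mul_assoc, Finset.sum_mul]
    congr 1
    simp_rw [smul_mul_assoc, h'.c, ← mul_smul_comm, ← Finset.mul_sum, Finset.smul_sum, smul_smul,
      Matrix.mul_apply, Finset.sum_smul]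
    rw [Finset.sum_comm]

lemma cd_mul_self (j : Fin N) : cd N j * cd N j = 0 := by
  rw [cd_eq_ladder, ladder_mul_self]

lemma c_mul_self (j : Fin N) : c N j * c N j = 0 := by
  rw [c_eq_ladder, ladder_mul_self]

lemma cd_c_mul_cd (i j k : Fin N) :
    cd N i * c N j * cd N k = cd N k * (cd N i * c N j) + if j = k then cd N i else 0 := by
  rw [mul_assoc, c_mul_cd, mul_sub, ← mul_assoc, cd_mul_cd, neg_mul, sub_neg_eq_add, mul_assoc,
    mul_ite, mul_one, mul_zero, add_comm]

lemma c_mul_cd_c (i j k : Fin N) :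
    c N k * (cd N i * c N j) = cd N i * c N j * c N k + if k = i then c N j else 0 := by
  rw [← mul_assoc, c_mul_cd, sub_mul, mul_assoc, c_mul_c, mul_neg, sub_neg_eq_add, mul_assoc,
    ite_mul, one_mul, zero_mul, add_comm]

/-- The exponential of an off-diagonal bilinear. -/
def transvectionUnit {i j : Fin N} (hij : i ≠ j) (t : ℂ) : (Op N)ˣ where
  val := 1 + t • (cd N i * c N j)
  inv := 1 - t • (cd N i * c N j)
  val_inv := by
    have h : cd N i * c N j * (cd N i * c N j) = 0 := by
      rw [← mul_assoc, cd_c_mul_cd, if_neg hij.symm, add_zero, ← mul_assoc, cd_mul_self, zero_mul,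
        zero_mul]
    rw [add_mul, one_mul, mul_sub, mul_one, smul_mul_smul_comm, h, smul_zero, sub_zero,
      sub_add_cancel]
  inv_val := by
    have h : cd N i * c N j * (cd N i * c N j) = 0 := by
      rw [← mul_assoc, cd_c_mul_cd, if_neg hij.symm, add_zero, ← mul_assoc, cd_mul_self, zero_mul,
        zero_mul]
    rw [sub_mul, one_mul, mul_add, mul_one, smul_mul_smul_comm, h, smul_zero, add_zero,
      add_sub_cancel_right]

lemma implements_transvection {i j : Fin N} (hij : i ≠ j) (t : ℂ) :
    ImplementsModeChange (transvection i j t) (transvectionUnit hij t) where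
  cd k := by
    have e : ∑ l, transvection i j t l k • cd N l = cd N k + if j = k then t • cd N i else 0 := by
      simp [transvection, Matrix.add_apply, add_smul, Finset.sum_add_distrib, Matrix.one_apply,
        Matrix.single_apply, ite_and]
    rw [e, transvectionUnit]
    simp only [add_mul, mul_add, one_mul, mul_one, smul_mul_assoc, mul_smul_comm, cd_c_mul_cd]
    split_ifs with h
    · simp only [smul_mul_assoc, ← mul_assoc, cd_mul_self, zero_mul, smul_zero,
        smul_add]
      abel
    · simp
  c k := by
    have e : ∑ l, transvection i j t k l • c N l = c N k + if k = i then t • c N j else 0 := by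
      simp [transvection, Matrix.add_apply, add_smul, Finset.sum_add_distrib, Matrix.one_apply,
        Matrix.single_apply, ite_and, eq_comm]
    rw [e, transvectionUnit]
    simp only [add_mul, mul_add, one_mul, mul_one, smul_mul_assoc, mul_smul_comm, c_mul_cd_c]
    split_ifs with h
    · simp only [mul_smul_comm, mul_assoc, c_mul_self, mul_zero, smul_zero,
        smul_add]
      abel
    · simp

/-- The eigenvalue of a configuration under the diagonal mode change `D`. -/
def modeScale (D : Fin N → ℂ) (x : Fin N → Fin 2) : ℂ := ∏ i, if x i = 0 then D i else 1

lemma modeScale_ne_zero {D : Fin N → ℂ} (hD : ∀ i, D i ≠ 0) (x : Fin N → Fin 2) :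
    modeScale D x ≠ 0 :=
  Finset.prod_ne_zero_iff.mpr fun i _ => by split_ifs <;> simp [hD]

lemma modeScale_update (D : Fin N → ℂ) (x : Fin N → Fin 2) (j : Fin N) :
    modeScale D (Function.update x j 0) = D j * modeScale D (Function.update x j 1) := by
  rw [modeScale, modeScale, ← Finset.mul_prod_erase _ _ (Finset.mem_univ j),
    ← Finset.mul_prod_erase _ (fun i => if Function.update x j 1 i = 0 then D i else 1)
      (Finset.mem_univ j), Function.update_self, Function.update_self, if_pos rfl,
    if_neg (by decide), one_mul]
  congr 1
  refine Finset.prod_congr rfl fun i hi => ?_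
  rw [Function.update_of_ne (Finset.ne_of_mem_erase hi),
    Function.update_of_ne (Finset.ne_of_mem_erase hi)]

/-- The diagonal operator implementing a rescaling of the modes. -/
def diagonalUnit {D : Fin N → ℂ} (hD : ∀ i, D i ≠ 0) : (Op N)ˣ where
  val := Matrix.diagonal (modeScale D)
  inv := Matrix.diagonal fun x => (modeScale D x)⁻¹
  val_inv := by simp [modeScale_ne_zero hD]
  inv_val := by simp [modeScale_ne_zero hD]

lemma implements_diagonal {D : Fin N → ℂ} (hD : ∀ i, D i ≠ 0) :
    ImplementsModeChange (Matrix.diagonal D) (diagonalUnit hD) where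
  cd j := by
    have e : ∑ i, Matrix.diagonal D i j • cd N i = D j • cd N j := by
      simp [Matrix.diagonal_apply]
    rw [e, diagonalUnit]
    ext x y
    rw [Matrix.diagonal_mul, Matrix.mul_diagonal, cd_eq_ladder, Matrix.smul_apply, ladder,
      Matrix.of_apply]
    split_ifs with h
    · obtain ⟨h1, rfl⟩ := h
      have := modeScale_update D x j
      rw [← h1, Function.update_eq_self] at this
      rw [this, smul_eq_mul, show Fin.rev (0 : Fin 2) = 1 from rfl]
      ring
    · simp
  c i := by
    have e : ∑ j, Matrix.diagonal D i j • c N j = D i • c N i := by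
      simp [Matrix.diagonal_apply]
    rw [e, diagonalUnit]
    ext x y
    rw [Matrix.diagonal_mul, Matrix.mul_diagonal, c_eq_ladder, Matrix.smul_apply, ladder,
      Matrix.of_apply]
    split_ifs with h
    · obtain ⟨h1, rfl⟩ := h
      have := modeScale_update D x i
      rw [← h1, Function.update_eq_self] at this
      rw [show Fin.rev (1 : Fin 2) = 0 from rfl, this, smul_eq_mul]
      ring
    · simp

/-- Every invertible linear change of modes is implemented by an invertible operator. -/
lemma exists_implementsModeChange (M : Matrix (Fin N) (Fin N) ℂ) (hM : M.det ≠ 0) :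
    ∃ G, ImplementsModeChange M G := by
  refine Matrix.diagonal_transvection_induction_of_det_ne_zero
    (fun M => ∃ G, ImplementsModeChange M G) M hM (fun D hD => ?_) (fun T => ?_) ?_
  · rw [det_diagonal, Finset.prod_ne_zero_iff] at hD
    exact ⟨_, implements_diagonal fun i => hD i (Finset.mem_univ i)⟩
  · exact ⟨_, implements_transvection T.hij T.c⟩
  · rintro A B _ _ ⟨G, hG⟩ ⟨G', hG'⟩
    exact ⟨_, hG.mul hG'⟩

end Gauge

section OrderedSums

lemma sum_modes {L : ℕ} {R : Type*} [AddCommMonoid R] (h : Fin (2 * L) → R) :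
    ∑ j, h j = ∑ k : Fin L, (h (modeA k) + h (modeB k)) := by
  have hbij : Function.Bijective (Sum.elim (modeA (L := L)) modeB) := by
    refine ⟨modeA_injective.sumElim modeB_injective modeA_ne_modeB, fun j => ?_⟩
    obtain ⟨k, rfl | rfl⟩ := exists_eq_mode j
    · exact ⟨Sum.inl k, rfl⟩
    · exact ⟨Sum.inr k, rfl⟩
  rw [← hbij.sum_comp, Fintype.sum_sum_type, Finset.sum_add_distrib]
  rfl

/-- The sum of ordered products of a family of ring elements. -/
def orderedSum {R : Type*} [Ring R] (g : Fin N → R) : R := ∑ j, ∑ k ∈ Finset.Ioi j, g j * g k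

lemma sum_powersetCard_two {R : Type*} [Ring R] (g : Fin N → R) :
    ∑ s ∈ Finset.univ.powersetCard 2, ((s.sort (· ≤ ·)).map g).prod = orderedSum g := by
  rw [orderedSum, Finset.sum_sigma']
  symm
  refine Finset.sum_bij (fun p _ => {p.1, p.2}) ?_ ?_ ?_ ?_
  · rintro ⟨j, k⟩ h
    have hjk : j < k := by simpa using h
    simp [Finset.mem_powersetCard, Finset.card_pair hjk.ne]
  · rintro ⟨j, k⟩ h ⟨j', k'⟩ h' he
    have hjk : j < k := by simpa using h
    have hjk' : j' < k' := by simpa using h'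
    have h1 : j ∈ ({j', k'} : Finset (Fin N)) := by rw [← he]; simp
    have h2 : k ∈ ({j', k'} : Finset (Fin N)) := by rw [← he]; simp
    simp only [Finset.mem_insert, Finset.mem_singleton] at h1 h2
    have : j = j' ∧ k = k' := by omega
    rw [this.1, this.2]
  · intro s hs
    obtain ⟨j, k, hne, rfl⟩ := Finset.card_eq_two.mp (Finset.mem_powersetCard.mp hs).2
    rcases hne.lt_or_gt with h | h
    · exact ⟨⟨j, k⟩, by simpa using h, rfl⟩
    · exact ⟨⟨k, j⟩, by simpa using h, Finset.pair_comm _ _⟩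
  · rintro ⟨j, k⟩ h
    have hjk : j < k := by simpa using h
    have : ({j, k} : Finset (Fin N)).sort (· ≤ ·) = [j, k] := by
      rw [Finset.sort_insert]
      · simp
      · simp [hjk.le]
      · simpa using hjk.ne
    simp [this]

lemma orderedSum_eq_sum_Iio {R : Type*} [Ring R] (g : Fin N → R) :
    orderedSum g = ∑ k, (∑ j ∈ Finset.Iio k, g j) * g k := by
  rw [orderedSum]
  simp_rw [Finset.sum_mul]
  exact Finset.sum_comm' (by simp)

lemma map_orderedSum {R S : Type*} [Ring R] [Ring S] (φ : R →+* S) (g : Fin N → R) :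
    φ (orderedSum g) = orderedSum fun j => φ (g j) := by
  simp [orderedSum]

lemma sum_Ioi_modeB {L : ℕ} {R : Type*} [AddCommMonoid R] (h : Fin (2 * L) → R) (i : Fin L) :
    ∑ j ∈ Finset.Ioi (modeB i), h j = ∑ k ∈ Finset.Ioi i, (h (modeA k) + h (modeB k)) := by
  have e1 : Finset.Ioi (modeB i) = Finset.univ.filter (modeB i < ·) := by ext; simp
  have e2 : Finset.Ioi i = Finset.univ.filter (i < ·) := by ext; simp
  rw [e1, e2, Finset.sum_filter, Finset.sum_filter, sum_modes]
  refine Finset.sum_congr rfl fun k _ => ?_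
  have h1 : modeB i < modeA k ↔ i < k := by simp only [modeA, modeB, Fin.lt_def]; omega
  have h2 : modeB i < modeB k ↔ i < k := by simp only [modeB, Fin.lt_def]; omega
  simp only [h1, h2]
  split_ifs <;> simp

lemma sum_Ioi_modeA {L : ℕ} {R : Type*} [AddCommMonoid R] (h : Fin (2 * L) → R) (i : Fin L) :
    ∑ j ∈ Finset.Ioi (modeA i), h j =
      h (modeB i) + ∑ k ∈ Finset.Ioi i, (h (modeA k) + h (modeB k)) := by
  have e : Finset.Ioi (modeA i) = insert (modeB i) (Finset.Ioi (modeB i)) := by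
    ext j
    simp only [modeA, modeB, Finset.mem_Ioi, Finset.mem_insert, Fin.lt_def, Fin.ext_iff]
    omega
  rw [e, Finset.sum_insert (by simp), sum_Ioi_modeB]

lemma sum_Iio_modeA {L : ℕ} {R : Type*} [AddCommMonoid R] (h : Fin (2 * L) → R) (i : Fin L) :
    ∑ j ∈ Finset.Iio (modeA i), h j = ∑ k ∈ Finset.Iio i, (h (modeA k) + h (modeB k)) := by
  have e1 : Finset.Iio (modeA i) = Finset.univ.filter (· < modeA i) := by ext; simp
  have e2 : Finset.Iio i = Finset.univ.filter (· < i) := by ext; simp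
  rw [e1, e2, Finset.sum_filter, Finset.sum_filter, sum_modes]
  refine Finset.sum_congr rfl fun k _ => ?_
  have h1 : modeA k < modeA i ↔ k < i := by simp only [modeA, Fin.lt_def]; omega
  have h2 : modeB k < modeA i ↔ k < i := by simp only [modeA, modeB, Fin.lt_def]; omega
  simp only [h1, h2]
  split_ifs <;> simp

lemma sum_Iio_modeB {L : ℕ} {R : Type*} [AddCommMonoid R] (h : Fin (2 * L) → R) (i : Fin L) :
    ∑ j ∈ Finset.Iio (modeB i), h j =
      h (modeA i) + ∑ k ∈ Finset.Iio i, (h (modeA k) + h (modeB k)) := by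
  have e : Finset.Iio (modeB i) = insert (modeA i) (Finset.Iio (modeA i)) := by
    ext j
    simp only [modeA, modeB, Finset.mem_Iio, Finset.mem_insert, Fin.lt_def, Fin.ext_iff]
    omega
  rw [e, Finset.sum_insert (by simp), sum_Iio_modeA]

lemma two_smul_orderedSum {R : Type*} [Ring R] (g : Fin N → R)
    (hg : ∀ j k, g j * g k = -(g k * g j)) :
    (2 : ℤ) • orderedSum g =
      ∑ j, ∑ k, (if j < k then (1 : ℤ) else if k < j then -1 else 0) • (g j * g k) := by
  have h1 : orderedSum g = ∑ j, ∑ k, if j < k then g j * g k else 0 := by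
    simp only [orderedSum, ← Finset.sum_filter]
    exact Finset.sum_congr rfl fun j _ => Finset.sum_congr (by ext; simp) fun _ _ => rfl
  have h2 : orderedSum g = ∑ j, ∑ k, if k < j then -(g j * g k) else 0 := by
    rw [h1, Finset.sum_comm]
    exact Finset.sum_congr rfl fun j _ => Finset.sum_congr rfl fun k _ => by rw [hg k j]
  rw [two_smul]
  nth_rewrite 1 [h1]
  rw [h2]
  simp only [← Finset.sum_add_distrib]
  refine Finset.sum_congr rfl fun j _ => Finset.sum_congr rfl fun k _ => ?_
  rcases lt_trichotomy j k with h | rfl | h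
  · simp [h, h.not_gt]
  · simp
  · simp [h, h.not_gt]

lemma val_fshift2 (hN : 2 ≤ N) (j : Fin N) :
    (fshift2 j : ℕ) = if (j : ℕ) + 2 < N then (j : ℕ) + 2 else (j : ℕ) + 2 - N := by
  simp only [fshift2]
  split_ifs with h
  · exact Nat.mod_eq_of_lt h
  · rw [Nat.mod_eq_sub_mod (by omega), Nat.mod_eq_of_lt (by omega)]

/-- The ordered sum of anticommuting elements is invariant under the antiperiodic translation by
two sites. -/
lemma orderedSum_twist {R : Type*} [Ring R] [Algebra ℂ R] (hN : 2 ≤ N) (g : Fin N → R)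
    (hg : ∀ j k, g j * g k = -(g k * g j)) :
    (orderedSum fun j : Fin N => if (j : ℕ) + 2 < N then g (fshift2 j) else -g (fshift2 j)) =
      orderedSum g := by
  have hbij : Function.Bijective (fshift2 (N := N)) := by
    refine Finite.injective_iff_bijective.mp fun j k h => Fin.ext ?_
    have := congrArg Fin.val h
    rw [val_fshift2 hN, val_fshift2 hN] at this
    split_ifs at this <;> omega
  have h2 : IsUnit ((2 : ℤ) : ℂ) := by simp
  have hcancel : ∀ x y : R, (2 : ℤ) • x = (2 : ℤ) • y → x = y := fun x y h => by
    rw [← Int.cast_smul_eq_zsmul ℂ, ← Int.cast_smul_eq_zsmul ℂ] at h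
    exact h2.smul_left_cancel.mp h
  refine (hcancel _ _ ?_).symm
  rw [two_smul_orderedSum _ hg, two_smul_orderedSum, ← hbij.sum_comp]
  · refine Finset.sum_congr rfl fun j _ => ?_
    rw [← hbij.sum_comp]
    refine Finset.sum_congr rfl fun k _ => ?_
    have hj := val_fshift2 hN j
    have hk := val_fshift2 hN k
    simp only [Fin.lt_def]
    split_ifs at hj hk ⊢ <;> first | omega | simp
  · intro j k
    split_ifs <;> simp [hg (fshift2 j) (fshift2 k)]

end OrderedSums

section TriangularModes

variable {L : ℕ} {R : Type*} [Ring R]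

/-- The families `g`, `gd` are obtained from the paired modes by the triangular change of modes
that turns the ordered sums of `g` and `gd` into the pair operators. -/
structure TriangularModes (a b A B : Fin L → R) (g gd : Fin (2 * L) → R) : Prop where
  gA : ∀ k, g (modeA k) = a k + ∑ l ∈ Finset.Ioi k, (a l + b l)
  gB : ∀ k, g (modeB k) = b k - ∑ l ∈ Finset.Ioi k, (a l + b l)
  gdA : ∀ k, gd (modeA k) = -A k - ∑ l ∈ Finset.Iio k, (B l - A l)
  gdB : ∀ k, gd (modeB k) = B k + ∑ l ∈ Finset.Iio k, (B l - A l)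

/-- The antiperiodic sum of neighbours of a family on the chain. -/
def twistSum (g : Fin (2 * L) → R) (j : Fin (2 * L)) : R :=
  if h : (j : ℕ) + 1 < 2 * L then g j + g ⟨(j : ℕ) + 1, h⟩ else g j - g ⟨0, j.pos⟩

lemma map_twistSum {S F : Type*} [Ring S] [FunLike F R S] [RingHomClass F R S] (φ : F)
    (g : Fin (2 * L) → R) (j : Fin (2 * L)) :
    φ (twistSum g j) = twistSum (fun k => φ (g k)) j := by
  unfold twistSum
  split_ifs <;> simp

variable [Algebra ℂ R]

/-- The pair of antiperiodic neighbour sums, with the staggered sign. -/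
def twistPair (g gd : Fin (2 * L) → R) (j : Fin (2 * L)) : R × R :=
  (twistSum g j, (-1 : ℂ) ^ (j : ℕ) • twistSum gd j)

lemma sum_Ioi_of_val_succ {M : Type*} [AddCommMonoid M] {i j : Fin N} (hij : (j : ℕ) = i + 1)
    (h : Fin N → M) : ∑ l ∈ Finset.Ioi i, h l = h j + ∑ l ∈ Finset.Ioi j, h l := by
  have e : Finset.Ioi i = insert j (Finset.Ioi j) := by
    ext l
    simp only [Finset.mem_Ioi, Finset.mem_insert, Fin.lt_def, Fin.ext_iff]
    omega
  rw [e, Finset.sum_insert (by simp)]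

lemma sum_Iio_of_val_succ {M : Type*} [AddCommMonoid M] {i j : Fin N} (hij : (j : ℕ) = i + 1)
    (h : Fin N → M) : ∑ l ∈ Finset.Iio j, h l = h i + ∑ l ∈ Finset.Iio i, h l := by
  have e : Finset.Iio j = insert i (Finset.Iio i) := by
    ext l
    simp only [Finset.mem_Iio, Finset.mem_insert, Fin.lt_def, Fin.ext_iff]
    omega
  rw [e, Finset.sum_insert (by simp)]

lemma mul_self_eq_zero_of_anticomm {x : R} (h : x * x = -(x * x)) : x * x = 0 := by
  have h2 : (2 : ℂ) • (x * x) = 0 := by rw [two_smul]; nth_rewrite 1 [h]; exact neg_add_cancel _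
  exact (smul_eq_zero_iff_right (r := (2 : ℂ)) two_ne_zero).mp h2

namespace TriangularModes

variable {a b A B : Fin L → R} {g gd : Fin (2 * L) → R}

lemma sum_add_mem_modeSpan (s : Finset (Fin L)) :
    (∑ l ∈ s, (a l + b l), ∑ l ∈ s, (B l - A l)) ∈ modeSpan a b A B := by
  have : (∑ l ∈ s, (a l + b l), ∑ l ∈ s, (B l - A l)) = ∑ l ∈ s, ((a l, B l) + (b l, -A l)) := by
    simp [Prod.ext_iff, Prod.fst_sum, Prod.snd_sum, sub_eq_add_neg]
  rw [this]
  exact Submodule.sum_mem _ fun l _ => add_mem (mk_a_mem_modeSpan l) (mk_b_mem_modeSpan l)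

lemma orderedSum_lower (h : PairedCAR a b A B) (t : TriangularModes a b A B g gd) :
    orderedSum g = pairLower a b := by
  simp only [orderedSum, ← Finset.mul_sum]
  rw [sum_modes, pairLower]
  refine Finset.sum_congr rfl fun i _ => ?_
  have hs : ∀ l, g (modeA l) + g (modeB l) = a l + b l := fun l => by rw [t.gA, t.gB]; abel
  rw [sum_Ioi_modeA, sum_Ioi_modeB]
  simp only [hs]
  rw [t.gA, t.gB]
  have hT := sum_add_mem_modeSpan (a := a) (b := b) (A := A) (B := B) (Finset.Ioi i)
  have h1 := h.fst_anticomm hT (mk_b_mem_modeSpan i)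
  have h2 := mul_self_eq_zero_of_anticomm (h.fst_anticomm hT hT)
  simp only at h1 h2
  generalize ∑ l ∈ Finset.Ioi i, (a l + b l) = T at *
  rw [sub_add_cancel, add_mul, sub_mul, h1, h2]
  abel

lemma orderedSum_raise (h : PairedCAR a b A B) (t : TriangularModes a b A B g gd) :
    orderedSum gd = pairRaise A B := by
  rw [orderedSum_eq_sum_Iio, sum_modes, pairRaise]
  refine Finset.sum_congr rfl fun i _ => ?_
  have hs : ∀ l, gd (modeA l) + gd (modeB l) = B l - A l := fun l => by rw [t.gdA, t.gdB]; abel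
  rw [sum_Iio_modeA, sum_Iio_modeB]
  simp only [hs]
  rw [t.gdA, t.gdB]
  have hT := sum_add_mem_modeSpan (a := a) (b := b) (A := A) (B := B) (Finset.Iio i)
  have h1 := h.snd_anticomm hT (mk_b_mem_modeSpan i)
  have h2 := mul_self_eq_zero_of_anticomm (h.snd_anticomm hT hT)
  have h3 := h.AB i i
  simp only [mul_neg, neg_mul, neg_neg] at h1 h2
  generalize ∑ l ∈ Finset.Iio i, (B l - A l) = T at *
  rw [sub_add_cancel, mul_sub, h2, mul_neg, neg_mul, mul_add, h3, h1]
  abel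

lemma twistPair_modeA (t : TriangularModes a b A B g gd) (i : Fin L) :
    twistPair g gd (modeA i) = (a i, B i) + (b i, -A i) := by
  have h : ((modeA i : Fin (2 * L)) : ℕ) + 1 < 2 * L := by simp only [modeA]; omega
  have h' : (⟨((modeA i : Fin (2 * L)) : ℕ) + 1, h⟩ : Fin (2 * L)) = modeB i := rfl
  have he : (-1 : ℂ) ^ ((modeA i : Fin (2 * L)) : ℕ) = 1 := by simp [modeA]
  rw [twistPair, twistSum, twistSum, dif_pos h, dif_pos h, h', he, t.gA, t.gB, t.gdA, t.gdB,
    one_smul]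
  ext <;> simp; abel

lemma twistPair_modeB (t : TriangularModes a b A B g gd) {i j : Fin L} (hij : (j : ℕ) = i + 1) :
    twistPair g gd (modeB i) = (b i, -A i) - (b j, -A j) := by
  have h : ((modeB i : Fin (2 * L)) : ℕ) + 1 < 2 * L := by simp only [modeB]; omega
  have h' : (⟨((modeB i : Fin (2 * L)) : ℕ) + 1, h⟩ : Fin (2 * L)) = modeA j := by
    simp only [modeA, modeB, Fin.mk.injEq]; omega
  have he : (-1 : ℂ) ^ ((modeB i : Fin (2 * L)) : ℕ) = -1 := by simp [modeB, pow_succ]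
  rw [twistPair, twistSum, twistSum, dif_pos h, dif_pos h, h', he, t.gA, t.gB, t.gdA, t.gdB,
    sum_Ioi_of_val_succ hij, sum_Iio_of_val_succ hij, neg_one_smul]
  ext <;> simp <;> abel

lemma twistPair_last (t : TriangularModes a b A B g gd) {i j : Fin L} (hi : (i : ℕ) + 1 = L)
    (hj : (j : ℕ) = 0) :
    twistPair g gd (modeB i) = (b i, -A i) + (b j, -A j) - ∑ k, ((a k, B k) + (b k, -A k)) := by
  have h : ¬ ((modeB i : Fin (2 * L)) : ℕ) + 1 < 2 * L := by simp only [modeB]; omega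
  have h' : (⟨0, (modeB i).pos⟩ : Fin (2 * L)) = modeA j := by simp [modeA, hj]
  have he : (-1 : ℂ) ^ ((modeB i : Fin (2 * L)) : ℕ) = -1 := by simp [modeB, pow_succ]
  have hIoi : Finset.Ioi i = ∅ := by
    ext l; simp only [Finset.mem_Ioi, Fin.lt_def, Finset.notMem_empty, iff_false]; omega
  have hIio : Finset.Iio j = ∅ := by
    ext l; simp only [Finset.mem_Iio, Fin.lt_def, Finset.notMem_empty, iff_false]; omega
  have h1 : (Finset.univ : Finset (Fin L)) = insert j (Finset.Ioi j) := by
    ext l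
    simp only [Finset.mem_Ioi, Finset.mem_insert, Fin.lt_def, Fin.ext_iff, Finset.mem_univ,
      true_iff]
    omega
  have h2 : (Finset.univ : Finset (Fin L)) = insert i (Finset.Iio i) := by
    ext l
    simp only [Finset.mem_Iio, Finset.mem_insert, Fin.lt_def, Fin.ext_iff, Finset.mem_univ,
      true_iff]
    omega
  have e1 : ∑ l, (a l + b l) = a j + b j + ∑ l ∈ Finset.Ioi j, (a l + b l) := by
    rw [h1, Finset.sum_insert (by simp)]
  have e2 : ∑ l, (B l - A l) = B i - A i + ∑ l ∈ Finset.Iio i, (B l - A l) := by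
    rw [h2, Finset.sum_insert (by simp)]
  have e3 : ∑ k, ((a k, B k) + (b k, -A k)) = (∑ l, (a l + b l), ∑ l, (B l - A l)) := by
    simp [Prod.ext_iff, Prod.fst_sum, Prod.snd_sum, sub_eq_add_neg]
  rw [e3, e1, e2, twistPair, twistSum, twistSum, dif_neg h, dif_neg h, h', he, t.gA, t.gB, t.gdA,
    t.gdB, hIoi, hIio, neg_one_smul, Finset.sum_empty, Finset.sum_empty]
  ext <;> simp <;> abel

lemma twistPair_mem (t : TriangularModes a b A B g gd) (j : Fin (2 * L)) :
    twistPair g gd j ∈ modeSpan a b A B := by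
  obtain ⟨i, rfl | rfl⟩ := exists_eq_mode j
  · rw [t.twistPair_modeA]
    exact add_mem (mk_a_mem_modeSpan i) (mk_b_mem_modeSpan i)
  · by_cases hi : (i : ℕ) + 1 < L
    · rw [t.twistPair_modeB (j := ⟨i + 1, hi⟩) rfl]
      exact sub_mem (mk_b_mem_modeSpan i) (mk_b_mem_modeSpan _)
    · rw [t.twistPair_last (j := ⟨0, i.pos⟩) (by omega) rfl]
      exact sub_mem (add_mem (mk_b_mem_modeSpan i) (mk_b_mem_modeSpan _))
        (Submodule.sum_mem _ fun l _ => add_mem (mk_a_mem_modeSpan l) (mk_b_mem_modeSpan l))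

/-- The antiperiodic neighbour sums span the modes. -/
lemma modeSpan_le (t : TriangularModes a b A B g gd) {S : Submodule ℂ (R × R)}
    (hS : ∀ j, twistPair g gd j ∈ S) : modeSpan a b A B ≤ S := by
  have hab : ∀ i, (a i, B i) + (b i, -A i) ∈ S := fun i => t.twistPair_modeA i ▸ hS (modeA i)
  have hdiff : ∀ (n : ℕ) (hn : n < L),
      (b ⟨0, by omega⟩, -A ⟨0, by omega⟩) - (b ⟨n, hn⟩, -A ⟨n, hn⟩) ∈ S := by
    intro n
    induction n with
    | zero => intro hn; rw [sub_self]; exact zero_mem S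
    | succ n ih =>
      intro hn
      have h1 := add_mem (ih (by omega)) (hS (modeB ⟨n, by omega⟩))
      rwa [t.twistPair_modeB (j := ⟨n + 1, hn⟩) rfl, sub_add_sub_cancel] at h1
  have hb : ∀ i, (b i, -A i) ∈ S := by
    intro i
    have hL : 0 < L := i.pos
    let z : Fin L := ⟨0, hL⟩
    let m : Fin L := ⟨L - 1, by omega⟩
    have hz : (b z, -A z) ∈ S := by
      have h1 := hS (modeB m)
      rw [t.twistPair_last (j := z) (by simp only [m]; omega) rfl] at h1
      have h2 := add_mem (add_mem h1 (Submodule.sum_mem S fun k (_ : k ∈ Finset.univ) => hab k))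
        (hdiff (L - 1) (by omega))
      have h3 : (2 : ℂ) • (b z, -A z) ∈ S := by
        convert h2 using 1
        rw [two_smul]
        change _ = (b m, -A m) + (b z, -A z) - _ + _ + ((b z, -A z) - (b m, -A m))
        abel
      exact (S.smul_mem_iff two_ne_zero).mp h3
    have := sub_mem hz (hdiff i i.2)
    rwa [sub_sub_cancel] at this
  refine Submodule.span_le.mpr ?_
  rintro _ (⟨i, rfl⟩ | ⟨i, rfl⟩)
  · simpa using sub_mem (hab i) (hb i)
  · exact hb i

end TriangularModes

end TriangularModes

section Gauge

variable {L : ℕ}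

/-- The coefficients of the triangular change of modes. -/
def triangularCoeff (i j : Fin (2 * L)) : ℂ :=
  (if i = j then 1 else 0) + if (i : ℕ) / 2 < (j : ℕ) / 2 then (-1) ^ (i : ℕ) else 0

lemma sum_triangularCoeff_smul (i : Fin (2 * L)) (x : Fin (2 * L) → Op (2 * L)) :
    ∑ j, triangularCoeff i j • x j =
      x i + (-1 : ℂ) ^ (i : ℕ) •
        ∑ j : Fin (2 * L), if (i : ℕ) / 2 < (j : ℕ) / 2 then x j else 0 := by
  simp only [triangularCoeff, add_smul, Finset.sum_add_distrib, Finset.smul_sum, ite_smul,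
    smul_ite, zero_smul, smul_zero, one_smul, Finset.sum_ite_eq, Finset.mem_univ, if_true]

lemma sum_triangularCoeff_smul' (j : Fin (2 * L)) (x : Fin (2 * L) → Op (2 * L)) :
    ∑ i : Fin (2 * L), ((-1 : ℂ) ^ ((i : ℕ) + 1) * triangularCoeff i j) • x i =
      (-1 : ℂ) ^ ((j : ℕ) + 1) • x j -
        ∑ i : Fin (2 * L), if (i : ℕ) / 2 < (j : ℕ) / 2 then x i else 0 := by
  have : ∀ i : Fin (2 * L), ((-1 : ℂ) ^ ((i : ℕ) + 1) * triangularCoeff i j) • x i =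
      (if i = j then (-1 : ℂ) ^ ((i : ℕ) + 1) • x i else 0) -
        if (i : ℕ) / 2 < (j : ℕ) / 2 then x i else 0 := fun i => by
    have h : (-1 : ℂ) ^ ((i : ℕ) + 1) * (-1) ^ (i : ℕ) = -1 := by
      rw [pow_succ, mul_right_comm, ← mul_pow]; simp
    rw [triangularCoeff, mul_add, add_smul, sub_eq_add_neg]
    congr 1
    · split_ifs <;> simp
    · split_ifs
      · rw [h, neg_one_smul]
      · simp
  simp [this]

lemma sum_ite_div_lt (k : Fin L) (x : Fin (2 * L) → Op (2 * L)) :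
    (∑ j : Fin (2 * L), if (k : ℕ) < (j : ℕ) / 2 then x j else 0) =
      ∑ l ∈ Finset.Ioi k, (x (modeA l) + x (modeB l)) := by
  rw [← sum_Ioi_modeB, ← Finset.sum_filter]
  refine Finset.sum_congr ?_ fun _ _ => rfl
  ext j
  simp only [modeB, Finset.mem_filter, Finset.mem_univ, true_and, Finset.mem_Ioi, Fin.lt_def]
  omega

lemma sum_ite_div_gt (k : Fin L) (x : Fin (2 * L) → Op (2 * L)) :
    (∑ j : Fin (2 * L), if (j : ℕ) / 2 < (k : ℕ) then x j else 0) =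
      ∑ l ∈ Finset.Iio k, (x (modeA l) + x (modeB l)) := by
  rw [← sum_Iio_modeA, ← Finset.sum_filter]
  refine Finset.sum_congr ?_ fun _ _ => rfl
  ext j
  simp only [modeA, Finset.mem_filter, Finset.mem_univ, true_and, Finset.mem_Iio, Fin.lt_def]
  omega

lemma modeA_div_two (k : Fin L) : ((modeA k : Fin (2 * L)) : ℕ) / 2 = k := by
  simp only [modeA]; omega

lemma modeB_div_two (k : Fin L) : ((modeB k : Fin (2 * L)) : ℕ) / 2 = k := by
  simp only [modeB]; omega

/-- An inner automorphism brings the `gl(1|1)` fermions into triangular form with respect to the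
Jordan–Wigner fermions. -/
lemma exists_triangularModes (L : ℕ) : ∃ Φ : Op (2 * L) ≃ₐ[ℂ] Op (2 * L),
    TriangularModes (fun k => c (2 * L) (modeA k)) (fun k => c (2 * L) (modeB k))
      (fun k => cd (2 * L) (modeA k)) (fun k => cd (2 * L) (modeB k))
      (fun j => Φ (f (2 * L) j)) (fun j => Φ (fd (2 * L) j)) := by
  let M : Matrix (Fin (2 * L)) (Fin (2 * L)) ℂ :=
    Matrix.of fun i j => (I ^ ((i : ℕ) + 1))⁻¹ * triangularCoeff i j
  have hM : ∀ i j, M i j = (I ^ ((i : ℕ) + 1))⁻¹ * triangularCoeff i j := fun _ _ => rfl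
  have hdet : M.det ≠ 0 := by
    rw [Matrix.det_of_isUpperTriangular, Finset.prod_ne_zero_iff]
    · intro i _
      simp [M, triangularCoeff]
    · intro i j hij
      have hij : j < i := hij
      have h1 : ¬ (i : ℕ) / 2 < (j : ℕ) / 2 := by rw [Fin.lt_def] at hij; omega
      simp [M, triangularCoeff, hij.ne', h1]
  obtain ⟨G, hG⟩ := exists_implementsModeChange M hdet
  let Φ := MulSemiringAction.toAlgEquiv ℂ (Op (2 * L)) (ConjAct.toConjAct G⁻¹)
  have hΦ : ∀ X, Φ X = (↑G⁻¹ : Op (2 * L)) * X * G := fun X => by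
    simp [Φ, ConjAct.units_smul_def]
  have hI : ∀ n : ℕ, (I ^ n) ≠ 0 := fun n => pow_ne_zero _ I_ne_zero
  have hf : ∀ i, Φ (f (2 * L) i) = ∑ j, triangularCoeff i j • c (2 * L) j := fun i => by
    rw [f, map_smul, hΦ, mul_assoc, hG.c, Units.inv_mul_cancel_left, Finset.smul_sum]
    refine Finset.sum_congr rfl fun j _ => ?_
    rw [smul_smul, hM, mul_inv_cancel_left₀ (hI _)]
  have hfd : ∀ j, cd (2 * L) j =
      ∑ i : Fin (2 * L), ((-1 : ℂ) ^ ((i : ℕ) + 1) * triangularCoeff i j) •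
        Φ (fd (2 * L) i) := fun j => by
    have h1 : cd (2 * L) j = ∑ i, M i j • Φ (cd (2 * L) i) := by
      have := congrArg (fun X => (↑G⁻¹ : Op (2 * L)) * X) (hG.cd j)
      simp only [Units.inv_mul_cancel_left] at this
      rw [this, ← mul_assoc, ← hΦ, map_sum]
      simp only [map_smul]
    rw [h1]
    refine Finset.sum_congr rfl fun i _ => ?_
    rw [fd, map_smul, smul_smul, hM]
    congr 1
    rw [← inv_pow, inv_I, neg_pow]
    ring
  have hA : ∀ k : Fin L, (-1 : ℂ) ^ ((modeA k : Fin (2 * L)) : ℕ) = 1 := by simp [modeA]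
  have hB : ∀ k : Fin L, (-1 : ℂ) ^ ((modeB k : Fin (2 * L)) : ℕ) = -1 := by
    simp [modeB, pow_succ]
  have hcA : ∀ k : Fin L, cd (2 * L) (modeA k) = -Φ (fd (2 * L) (modeA k)) -
      ∑ l ∈ Finset.Iio k, (Φ (fd (2 * L) (modeA l)) + Φ (fd (2 * L) (modeB l))) := fun k => by
    rw [hfd, sum_triangularCoeff_smul', pow_succ, hA, modeA_div_two, sum_ite_div_gt]
    simp
  have hcB : ∀ k : Fin L, cd (2 * L) (modeB k) = Φ (fd (2 * L) (modeB k)) -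
      ∑ l ∈ Finset.Iio k, (Φ (fd (2 * L) (modeA l)) + Φ (fd (2 * L) (modeB l))) := fun k => by
    rw [hfd, sum_triangularCoeff_smul', pow_succ, hB, modeB_div_two, sum_ite_div_gt]
    simp
  have hsub : ∀ k : Fin L, cd (2 * L) (modeB k) - cd (2 * L) (modeA k) =
      Φ (fd (2 * L) (modeA k)) + Φ (fd (2 * L) (modeB k)) := fun k => by
    rw [hcA, hcB]; abel
  refine ⟨Φ, fun k => ?_, fun k => ?_, fun k => ?_, fun k => ?_⟩
  · rw [hf, sum_triangularCoeff_smul, hA, modeA_div_two, sum_ite_div_lt, one_smul]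
  · rw [hf, sum_triangularCoeff_smul, hB, modeB_div_two, sum_ite_div_lt, neg_one_smul,
      sub_eq_add_neg]
  · simp only [hsub]; rw [hcA]; abel
  · simp only [hsub]; rw [hcB]; abel

end Gauge

section Centralizer

variable {L : ℕ}

lemma f_mul_f (j k : Fin N) : f N j * f N k = -(f N k * f N j) := by
  simp only [f, smul_mul_smul_comm]
  rw [c_mul_c, smul_neg, mul_comm]

lemma fd_mul_fd (j k : Fin N) : fd N j * fd N k = -(fd N k * fd N j) := by
  simp only [fd, smul_mul_smul_comm]
  rw [cd_mul_cd, smul_neg, mul_comm]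

lemma f_mul_fd_add (j k : Fin N) :
    f N j * fd N k + fd N k * f N j = if j = k then (-1 : ℂ) ^ ((j : ℕ) + 1) • 1 else 0 := by
  simp only [f, fd, smul_mul_smul_comm]
  rw [mul_comm (I ^ ((k : ℕ) + 1)), ← smul_add, c_mul_cd, sub_add_cancel]
  split_ifs with h
  · rw [h, ← mul_pow, I_mul_I]
  · simp

lemma Fg_two : Fg N 2 = orderedSum (f N) := sum_powersetCard_two _

lemma Fdg_two : Fdg N 2 = orderedSum (fd N) := sum_powersetCard_two _

lemma eTw_eq (j : Fin (2 * L)) :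
    eTw L j = twistSum (f (2 * L)) j * twistSum (fd (2 * L)) j := by
  unfold eTw twistSum
  split_ifs <;> rfl

/-- Neighbouring antiperiodic sums of fermions have a nonzero anticommutator. -/
lemma twistSum_anticomm_ne_zero {i : ℕ} (hi : i + 1 < 2 * L) :
    twistSum (f (2 * L)) ⟨i + 1, hi⟩ * twistSum (fd (2 * L)) ⟨i, by omega⟩ +
      twistSum (fd (2 * L)) ⟨i, by omega⟩ * twistSum (f (2 * L)) ⟨i + 1, hi⟩ ≠ 0 := by
  have key : ∀ x y z w : Op (2 * L), (x + y) * (z + w) + (z + w) * (x + y) =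
      (x * z + z * x) + (x * w + w * x) + (y * z + z * y) + (y * w + w * y) := fun x y z w => by
    noncomm_ring
  have key' : ∀ x y z w : Op (2 * L), (x - y) * (z + w) + (z + w) * (x - y) =
      (x * z + z * x) + (x * w + w * x) - (y * z + z * y) - (y * w + w * y) := fun x y z w => by
    noncomm_ring
  have hfd : twistSum (fd (2 * L)) ⟨i, by omega⟩ =
      fd (2 * L) ⟨i, by omega⟩ + fd (2 * L) ⟨i + 1, hi⟩ := dif_pos hi
  rw [hfd, twistSum]
  split_ifs with h
  · rw [key]
    simp [f_mul_fd_add, show i + 1 + 1 ≠ i by omega]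
  · rw [key']
    simp only [f_mul_fd_add, Fin.mk.injEq]
    rcases Nat.eq_zero_or_pos i with rfl | h0
    · have := smul_ne_zero (two_ne_zero (α := ℂ)) (one_ne_zero (α := Op (2 * L)))
      rw [two_smul] at this
      simpa using this
    · simp [h0.ne]

/-- Operators commuting with the antiperiodic Temperley–Lieb generators commute with the polarised
bilinears in the modes. -/
lemma commute_bilinear_of_commute_eTw {Φ : Op (2 * L) ≃ₐ[ℂ] Op (2 * L)}
    {a b A B : Fin L → Op (2 * L)} (h : PairedCAR a b A B)
    (t : TriangularModes a b A B (fun j => Φ (f (2 * L) j)) fun j => Φ (fd (2 * L) j))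
    {X : Op (2 * L)} (hX : ∀ j, Commute X (eTw L j)) {p q : Op (2 * L) × Op (2 * L)}
    (hp : p ∈ modeSpan a b A B) (hq : q ∈ modeSpan a b A B) :
    Commute (Φ X) (p.1 * q.2 + q.1 * p.2) := by
  set P := twistPair (fun j => Φ (f (2 * L) j)) fun j => Φ (fd (2 * L) j) with hP
  have hP1 : ∀ j, (P j).1 = Φ (twistSum (f (2 * L)) j) := fun j => (map_twistSum Φ _ j).symm
  have hP2 : ∀ j : Fin (2 * L), (P j).2 = (-1 : ℂ) ^ (j : ℕ) • Φ (twistSum (fd (2 * L)) j) :=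
    fun j => by rw [map_twistSum]; rfl
  let chainPair : ℕ → Op (2 * L) × Op (2 * L) := fun i => if hi : i < 2 * L then P ⟨i, hi⟩ else 0
  have hchain : ∀ i (hi : i < 2 * L), chainPair i = P ⟨i, hi⟩ := fun i hi => dif_pos hi
  have chain := h.bilinear_mem_of_chain (Z := Subalgebra.centralizer ℂ {Φ X}) (n := 2 * L)
    (p := chainPair) (fun i hi => by rw [hchain i hi]; exact t.twistPair_mem _)
    (fun i hi => by
      rw [hchain i hi, hP1, hP2, mul_smul_comm, ← map_mul, ← eTw_eq]
      refine Subalgebra.smul_mem _ (Subalgebra.mem_centralizer_iff ℂ |>.mpr ?_) _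
      rintro _ rfl
      exact ((hX _).map Φ).eq)
    (fun i hi => by
      rw [hchain i (by omega), hchain (i + 1) hi, hP1, hP2, mul_smul_comm, smul_mul_assoc,
        ← smul_add,
        ← map_mul, ← map_mul, ← map_add]
      exact smul_ne_zero (pow_ne_zero _ (by norm_num))
        ((map_ne_zero_iff Φ Φ.injective).mpr (twistSum_anticomm_ne_zero hi)))
  have hPP : ∀ i j, Commute (Φ X) ((P i).1 * (P j).2 + (P j).1 * (P i).2) := fun i j => by
    have := chain i i.2 j j.2
    rw [hchain i i.2, hchain j j.2] at this
    exact (Subalgebra.mem_centralizer_iff ℂ).mp this _ rfl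
  let S (q : Op (2 * L) × Op (2 * L)) : Submodule ℂ (Op (2 * L) × Op (2 * L)) :=
    { carrier := {p | Commute (Φ X) (p.1 * q.2 + q.1 * p.2)}
      zero_mem' := by simp
      add_mem' := fun {x y} hx hy => by
        have := Commute.add_right hx hy
        simp only [Set.mem_ofPred_eq, Prod.fst_add, Prod.snd_add, add_mul, mul_add]
        rwa [add_add_add_comm] at this
      smul_mem' := fun s x hx => by
        have := Commute.smul_right hx s
        simpa [smul_add] using this }
  have h1 : ∀ j, modeSpan a b A B ≤ S (P j) := fun j => t.modeSpan_le fun i => hPP i j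
  have h2 : modeSpan a b A B ≤ S p := t.modeSpan_le fun j => by
    have : Commute (Φ X) (p.1 * (P j).2 + (P j).1 * p.2) := h1 j hp
    rw [add_comm] at this
    exact this
  have h3 : Commute (Φ X) (q.1 * p.2 + p.1 * q.2) := h2 hq
  rwa [add_comm] at h3

lemma commute_twistPair {R : Type*} [Ring R] [Algebra ℂ R] {E : R} {p : R × R}
    (h : Commute E (p.1 * p.2 + p.1 * p.2)) : Commute E (p.1 * p.2) := by
  have := Commute.smul_right h (2⁻¹ : ℂ)
  rwa [← two_smul ℂ, smul_smul, inv_mul_cancel₀ two_ne_zero, one_smul] at this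

/-- The ordered sums of anticommuting families carried along by the twisted translation commute
with it. -/
lemma commute_orderedSum_of_twist (hL : 0 < L) (u : (Op (2 * L))ˣ) {g : Fin (2 * L) → Op (2 * L)}
    (hg : ∀ j k, g j * g k = -(g k * g j))
    (hu : ∀ j : Fin (2 * L), (u : Op (2 * L)) * g j * ((u⁻¹ : (Op (2 * L))ˣ) : Op (2 * L)) =
      if (j : ℕ) + 2 < 2 * L then g (fshift2 j) else -g (fshift2 j)) :
    Commute (u : Op (2 * L)) (orderedSum g) := by
  let φ := MulSemiringAction.toAlgEquiv ℂ (Op (2 * L)) (ConjAct.toConjAct u)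
  have hφ : ∀ X, φ X = u * X * (u⁻¹ : (Op (2 * L))ˣ) := fun X => by
    simp [φ, ConjAct.units_smul_def]
  have h := map_orderedSum (φ : Op (2 * L) →+* Op (2 * L)) g
  simp only [RingHom.coe_coe, hφ, hu] at h
  rw [orderedSum_twist (by omega) g hg, Units.mul_inv_eq_iff_eq_mul] at h
  exact h

lemma centralizer_adjoin {R : Type*} [Ring R] [Algebra ℂ R] (s : Set R) :
    Subalgebra.centralizer ℂ (Algebra.adjoin ℂ s : Set R) = Subalgebra.centralizer ℂ s := by
  refine le_antisymm (Subalgebra.centralizer_le ℂ _ _ Algebra.subset_adjoin) fun X hX => ?_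
  exact fun Y hY => (Algebra.adjoin_le_centralizer_centralizer ℂ s hY X hX).symm

end Centralizer

/-- **Theorem (centralizer of the twisted algebra `JTL_N^{tw}`).**  For any
invertible `u` implementing the twisted translation, the commutant of the
unital subalgebra generated by `{e_1, …, e_N, u, u⁻¹}` (the antiperiodic
spin-chain representation of `JTL_N^{tw}`) equals the unital subalgebra
generated by `F_(2)` and `F†_(2)` (the representation of `U(sl(2))`). -/
theorem gl11_twisted_JTL_centralizer (L : ℕ) (hL : 0 < L) :
    ∀ u : (Op (2 * L))ˣ, ImplementsTwistedTranslation L u →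
      Subalgebra.centralizer ℂ
        ((Algebra.adjoin ℂ
          (Set.range (eTw L) ∪ {(u : Op (2 * L)), ((u⁻¹ : (Op (2 * L))ˣ) : Op (2 * L))})
          : Subalgebra ℂ (Op (2 * L))) : Set (Op (2 * L))) =
        Algebra.adjoin ℂ {Fg (2 * L) 2, Fdg (2 * L) 2} := by
  intro u hu
  obtain ⟨Φ, t⟩ := exists_triangularModes L
  have hΦF : Φ (Fg (2 * L) 2) = chainLower L := by
    rw [Fg_two, chainLower, ← t.orderedSum_lower (pairedCAR_c L)]
    exact map_orderedSum (Φ : Op (2 * L) →+* Op (2 * L)) _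
  have hΦFd : Φ (Fdg (2 * L) 2) = chainRaise L := by
    rw [Fdg_two, chainRaise, ← t.orderedSum_raise (pairedCAR_c L)]
    exact map_orderedSum (Φ : Op (2 * L) →+* Op (2 * L)) _
  have hΦe : ∀ j : Fin (2 * L), ∃ p ∈ modeSpan (fun k => c (2 * L) (modeA k))
      (fun k => c (2 * L) (modeB k)) (fun k => cd (2 * L) (modeA k))
      (fun k => cd (2 * L) (modeB k)), Φ (eTw L j) = (-1 : ℂ) ^ (j : ℕ) • (p.1 * p.2) := by
    refine fun j => ⟨_, t.twistPair_mem j, ?_⟩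
    rw [twistPair, ← map_twistSum, ← map_twistSum, mul_smul_comm, smul_smul, ← mul_pow, eTw_eq,
      map_mul]
    simp
  rw [centralizer_adjoin]
  refine le_antisymm (fun X hX => ?_) (Algebra.adjoin_le ?_)
  · rw [Subalgebra.mem_centralizer_iff] at hX
    have hmem := (rootCommute_of_bilinear fun p q => commute_bilinear_of_commute_eTw
      (pairedCAR_c L) t fun j => (hX _ (Or.inl ⟨j, rfl⟩)).symm).mem_adjoin
    rw [← hΦF, ← hΦFd, ← Set.image_pair] at hmem
    obtain ⟨Y, hY, hYX⟩ := (AlgHom.map_adjoin (Φ : Op (2 * L) →ₐ[ℂ] Op (2 * L)) _).ge hmem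
    rwa [← Φ.injective hYX]
  · have key : ∀ F : Op (2 * L), (∀ j, Commute F (eTw L j)) → Commute (u : Op (2 * L)) F →
        F ∈ Subalgebra.centralizer ℂ (Set.range (eTw L) ∪
          {(u : Op (2 * L)), ((u⁻¹ : (Op (2 * L))ˣ) : Op (2 * L))}) := by
      intro F h1 h2
      rw [Subalgebra.mem_centralizer_iff]
      rintro _ (⟨j, rfl⟩ | rfl | rfl)
      · exact (h1 j).eq.symm
      · exact h2.eq
      · exact h2.units_inv_left.eq
    rintro _ (rfl | rfl)
    · refine key _ (fun j => ?_) ?_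
      · obtain ⟨p, hp, he⟩ := hΦe j
        refine Commute.of_map Φ.injective ?_
        rw [hΦF, he]
        exact (commute_twistPair ((pairedCAR_c L).pairLower_commute_bilinear hp hp)).smul_right _
      · rw [Fg_two]
        exact commute_orderedSum_of_twist hL u f_mul_f fun j => (hu j).1
    · refine key _ (fun j => ?_) ?_
      · obtain ⟨p, hp, he⟩ := hΦe j
        refine Commute.of_map Φ.injective ?_
        rw [hΦFd, he]
        exact (commute_twistPair ((pairedCAR_c L).pairRaise_commute_bilinear hp hp)).smul_right _
      · rw [Fdg_two]
        exact commute_orderedSum_of_twist hL u fd_mul_fd fun j => (hu j).2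

end SpinChain

end
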